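/- Limited-range Duoandikoetxea–Rosenthal extrapolation to weighted Morrey spaces: Let 1 ≤ p₋ ≤ p₁ ≤ p₊ < ∞ and let T be an operator defined and bounded on L^{p₁}(w) for all weights w ∈ A_{p₁/p₋}(ℝ^d) ∩ RH_{(p₊/p₁)'}(ℝ^d). Then for all p ∈ (p₋,p₊) (and also for p = p₋ if p₁ = p₋) and all σ > (p₊/p)', the operator T is bounded on 𝓛^{p,λ}(w) for all λ with 0 < λ < d(1 − p/p₊ − 1/σ) and all weights w ∈ A_{p/p₋}(ℝ^d) ∩ RH_σ(ℝ^d). -/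

import Mathlib

open MeasureTheory Filter ENNReal
open scoped ENNReal NNReal Topology

noncomputable section

namespace PaperMorrey

/-! ### Cubes, weights, Muckenhoupt classes -/

/-- The axis-parallel cube with corner `a` and side length `r`. -/
def cube {d : ℕ} (a : Fin d → ℝ) (r : ℝ) : Set (Fin d → ℝ) :=
  Set.univ.pi fun i => Set.Icc (a i) (a i + r)

/-- A weight on `ℝ^d`: a locally integrable, a.e. positive function. -/
def IsWeight (d : ℕ) (w : (Fin d → ℝ) → ℝ) : Prop :=
  LocallyIntegrable w volume ∧ ∀ᵐ x ∂(volume : Measure (Fin d → ℝ)), 0 < w x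

/-- Interpret a real-valued weight as an `ℝ≥0∞`-valued function. -/
def ofW {d : ℕ} (w : (Fin d → ℝ) → ℝ) : (Fin d → ℝ) → ℝ≥0∞ :=
  fun x => ENNReal.ofReal (w x)

/-- Average `⟨g⟩_Q = |Q|⁻¹ ∫_Q g` of an `ℝ≥0∞`-valued function over a cube. -/
def avg {d : ℕ} (g : (Fin d → ℝ) → ℝ≥0∞) (a : Fin d → ℝ) (r : ℝ) : ℝ≥0∞ :=
  (∫⁻ x in cube a r, g x) / volume (cube a r)

open Classical in
/-- The Muckenhoupt `A_p` characteristic `[w]_{A_p}` of a weight, for a finite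
exponent `1 ≤ p < ∞` (with the usual `L^∞` form when `p = 1`). -/
def apConst (d : ℕ) (p : ℝ) (w : (Fin d → ℝ) → ℝ) : ℝ≥0∞ :=
  if p = 1 then
    ⨆ (a : Fin d → ℝ) (r : ℝ) (_ : 0 < r),
      avg (ofW w) a r * essSup (fun x => (ofW w x)⁻¹) (volume.restrict (cube a r))
  else
    ⨆ (a : Fin d → ℝ) (r : ℝ) (_ : 0 < r),
      avg (ofW w) a r * (avg (fun x => ofW w x ^ (-(1 / (p - 1)))) a r) ^ (p - 1)

/-- Membership `w ∈ A_p(ℝ^d)` for finite `p ≥ 1`. -/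
def MemAp (d : ℕ) (p : ℝ) (w : (Fin d → ℝ) → ℝ) : Prop :=
  IsWeight d w ∧ apConst d p w ≠ ⊤

open Classical in
/-- The reverse Hölder `RH_σ` characteristic, for `σ ∈ [1,∞]` (an extended real);
`σ = 1` corresponds to the trivial class of all weights. -/
def rhConst (d : ℕ) (σ : ℝ≥0∞) (w : (Fin d → ℝ) → ℝ) : ℝ≥0∞ :=
  if σ = 1 then 0
  else if σ = ⊤ then
    ⨆ (a : Fin d → ℝ) (r : ℝ) (_ : 0 < r),
      essSup (ofW w) (volume.restrict (cube a r)) / avg (ofW w) a r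
  else
    ⨆ (a : Fin d → ℝ) (r : ℝ) (_ : 0 < r),
      (avg (fun x => ofW w x ^ σ.toReal) a r) ^ (1 / σ.toReal) / avg (ofW w) a r

/-- Membership `w ∈ RH_σ(ℝ^d)` for `σ ∈ [1,∞]`; `RH_1` is the class of all weights. -/
def MemRH (d : ℕ) (σ : ℝ≥0∞) (w : (Fin d → ℝ) → ℝ) : Prop :=
  IsWeight d w ∧ rhConst d σ w ≠ ⊤

open Classical in
/-- The conjugate exponent `q' = q/(q-1) ∈ [1,∞]` of a real exponent `q ≥ 1`,
as an extended real (`1' = ∞`). -/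
def eConj (q : ℝ) : ℝ≥0∞ :=
  if q ≤ 1 then ⊤ else ENNReal.ofReal (q / (q - 1))

open Classical in
/-- The conjugate exponent `(p₊/p)'` of the ratio of an extended exponent `p₊ ∈ (1,∞]`
and a finite exponent `p`; in particular it equals `1` when `p₊ = ∞`. -/
def ratioConj (pp : ℝ≥0∞) (p : ℝ) : ℝ≥0∞ :=
  if pp = ⊤ then 1 else eConj (pp.toReal / p)

/-! ### Weighted Lebesgue and Morrey norms -/

/-- The weighted Lebesgue norm `‖f‖_{L^p(w)} = (∫_{ℝ^d} |f|^p w)^{1/p}` (finite `p`). -/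
def wLpNorm (d : ℕ) (p : ℝ) (w : (Fin d → ℝ) → ℝ) (f : (Fin d → ℝ) → ℂ) : ℝ≥0∞ :=
  (∫⁻ x, (‖f x‖₊ : ℝ≥0∞) ^ p * ofW w x) ^ (1 / p)

/-- The Samko weighted Morrey norm
`‖f‖_{𝓛^{p,λ}(w)} = sup_Q |Q|^{-λ/(dp)} (∫_Q |f|^p w)^{1/p}`. -/
def morreyNorm (d : ℕ) (p lam : ℝ) (w : (Fin d → ℝ) → ℝ) (f : (Fin d → ℝ) → ℂ) : ℝ≥0∞ :=
  ⨆ (a : Fin d → ℝ) (r : ℝ) (_ : 0 < r),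
    volume (cube a r) ^ (-(lam / ((d : ℝ) * p))) *
      (∫⁻ x in cube a r, (‖f x‖₊ : ℝ≥0∞) ^ p * ofW w x) ^ (1 / p)

/-! ### Bounded and compact operators w.r.t. extended (semi)norms -/

/-- `T` is a bounded operator from the space with extended norm `N`
to the space with extended norm `M`. -/
def OpBounded {V W : Type*} (N : V → ℝ≥0∞) (M : W → ℝ≥0∞) (T : V → W) : Prop :=
  ∃ C : ℝ≥0∞, C ≠ ⊤ ∧ ∀ f, M (T f) ≤ C * N f

/-- `T` is a compact operator from the space with extended norm `N` to the
(complete) space with extended norm `M`: the image of the unit ball is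
totally bounded, i.e. every sequence in it has a subsequence whose image
is Cauchy in `M`. -/
def OpCompact {V W : Type*} [AddCommGroup W] (N : V → ℝ≥0∞) (M : W → ℝ≥0∞) (T : V → W) : Prop :=
  ∀ f : ℕ → V, (∀ n, N (f n) ≤ 1) →
    ∃ φ : ℕ → ℕ, StrictMono φ ∧
      ∀ ε : ℝ≥0∞, 0 < ε → ∃ K : ℕ, ∀ m ≥ K, ∀ n ≥ K,
        M (T (f (φ m)) - T (f (φ n))) < ε

/-! ### BMO, CMO and commutators -/

/-- Average of a real function over a cube. -/
def cavg {d : ℕ} (g : (Fin d → ℝ) → ℝ) (a : Fin d → ℝ) (r : ℝ) : ℝ :=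
  (volume (cube a r)).toReal⁻¹ * ∫ x in cube a r, g x

/-- The BMO norm `sup_Q ⟨|b - ⟨b⟩_Q|⟩_Q`. -/
def bmoNorm (d : ℕ) (b : (Fin d → ℝ) → ℝ) : ℝ≥0∞ :=
  ⨆ (a : Fin d → ℝ) (r : ℝ) (_ : 0 < r),
    ENNReal.ofReal (cavg (fun x => |b x - cavg b a r|) a r)

/-- `b ∈ BMO(ℝ^d)`. -/
def MemBMO (d : ℕ) (b : (Fin d → ℝ) → ℝ) : Prop :=
  LocallyIntegrable b volume ∧ bmoNorm d b ≠ ⊤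

/-- `b ∈ CMO(ℝ^d)`: `b` lies in the closure of `C_c^∞(ℝ^d)` in the BMO norm. -/
def MemCMO (d : ℕ) (b : (Fin d → ℝ) → ℝ) : Prop :=
  MemBMO d b ∧ ∀ ε : ℝ≥0∞, 0 < ε → ∃ g : (Fin d → ℝ) → ℝ,
    ContDiff ℝ (⊤ : ℕ∞) g ∧ HasCompactSupport g ∧ bmoNorm d (fun x => b x - g x) < ε

/-- The commutator `[b,T] f = b · T f - T (b · f)`. -/
def commutator {d : ℕ} (b : (Fin d → ℝ) → ℝ)
    (T : ((Fin d → ℝ) → ℂ) → ((Fin d → ℝ) → ℂ)) :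
    ((Fin d → ℝ) → ℂ) → ((Fin d → ℝ) → ℂ) :=
  fun f x => (b x : ℂ) * T f x - T (fun y => (b y : ℂ) * f y) x

/-- The Euclidean norm on `ℝ^d` (the underlying type carries the sup norm). -/
def euclidNorm {d : ℕ} (x : Fin d → ℝ) : ℝ :=
  Real.sqrt (∑ i, x i ^ 2)

end PaperMorrey

namespace PaperMorrey

open Metric

section MaximalFunction

variable {d : ℕ}

/-! ### Maximal functions of doubling measures -/

/-- The uncentred maximal function over (sup-norm) balls with respect to a measure `ν`. -/
def maxFn (ν : Measure (Fin d → ℝ)) (f : (Fin d → ℝ) → ℝ≥0∞) (x : Fin d → ℝ) : ℝ≥0∞ :=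
  ⨆ (c : Fin d → ℝ) (r : ℝ) (_ : x ∈ ball c r), (∫⁻ y in ball c r, f y ∂ν) / ν (ball c r)

lemma le_maxFn (ν : Measure (Fin d → ℝ)) (f : (Fin d → ℝ) → ℝ≥0∞) {x c : Fin d → ℝ} {r : ℝ}
    (hx : x ∈ ball c r) : (∫⁻ y in ball c r, f y ∂ν) / ν (ball c r) ≤ maxFn ν f x :=
  le_iSup_of_le c <| le_iSup_of_le r <| le_iSup_of_le hx le_rfl

lemma lt_maxFn_iff {ν : Measure (Fin d → ℝ)} {f : (Fin d → ℝ) → ℝ≥0∞} {x : Fin d → ℝ}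
    {t : ℝ≥0∞} : t < maxFn ν f x ↔
      ∃ c r, x ∈ ball c r ∧ t < (∫⁻ y in ball c r, f y ∂ν) / ν (ball c r) := by
  simp [maxFn, lt_iSup_iff]

lemma measurable_maxFn (ν : Measure (Fin d → ℝ)) (f : (Fin d → ℝ) → ℝ≥0∞) :
    Measurable (maxFn ν f) := by
  refine measurable_of_Ioi fun t => IsOpen.measurableSet ?_
  rw [isOpen_iff_forall_mem_open]
  intro x hx
  obtain ⟨c, r, hxr, ht⟩ := lt_maxFn_iff.1 hx
  exact ⟨ball c r, fun y hy => lt_maxFn_iff.2 ⟨c, r, hy, ht⟩, isOpen_ball, hxr⟩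

/-- A measure is doubling on balls, with constant `D`, and gives balls positive finite mass. -/
structure IsDoublingWith (ν : Measure (Fin d → ℝ)) (D : ℝ≥0∞) : Prop where
  pos : ∀ c r, 0 < r → ν (ball c r) ≠ 0
  fin : ∀ c r, ν (ball c r) ≠ ⊤
  const_ne_top : D ≠ ⊤
  le : ∀ c r, 0 < r → ν (ball c (5 * r)) ≤ D * ν (ball c r)

lemma measure_biUnion_ball_le_of_bdd {ν : Measure (Fin d → ℝ)} {D : ℝ≥0∞}
    (hν : IsDoublingWith ν D) (t : Set ((Fin d → ℝ) × ℝ)) (R : ℝ)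
    (ht : ∀ b ∈ t, 0 < b.2) (hR : ∀ b ∈ t, b.2 ≤ R) (g : (Fin d → ℝ) → ℝ≥0∞)
    (h : ∀ b ∈ t, ν (ball b.1 b.2) ≤ ∫⁻ y in ball b.1 b.2, g y ∂ν) :
    ν (⋃ b ∈ t, ball b.1 b.2) ≤ D * ∫⁻ y, g y ∂ν := by
  obtain ⟨u, hut, hdisj, hcov⟩ := Vitali.exists_disjoint_subfamily_covering_enlargement_ball
    t Prod.fst Prod.snd R hR 5 (by norm_num)
  have hcount : u.Countable := by
    refine hdisj.countable_of_isOpen (fun b _ => isOpen_ball) fun b hb => ?_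
    exact nonempty_ball.2 (ht b (hut hb))
  calc ν (⋃ b ∈ t, ball b.1 b.2) ≤ ν (⋃ b ∈ u, ball b.1 (5 * b.2)) := by
        refine measure_mono (Set.iUnion₂_subset fun a ha => ?_)
        obtain ⟨b, hb, hab⟩ := hcov a ha
        exact hab.trans (Set.subset_biUnion_of_mem (u := fun b => ball b.1 (5 * b.2)) hb)
    _ ≤ ∑' b : u, ν (ball b.1.1 (5 * b.1.2)) := measure_biUnion_le ν hcount _
    _ ≤ ∑' b : u, D * ∫⁻ y in ball b.1.1 b.1.2, g y ∂ν := by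
        gcongr with b
        exact (hν.le _ _ (ht b (hut b.2))).trans (by gcongr; exact h b (hut b.2))
    _ = D * ∫⁻ y in ⋃ b ∈ u, ball b.1 b.2, g y ∂ν := by
        rw [ENNReal.tsum_mul_left, lintegral_biUnion hcount (fun _ _ => measurableSet_ball) hdisj]
    _ ≤ D * ∫⁻ y, g y ∂ν := by gcongr; exact Measure.restrict_le_self

lemma measure_biUnion_ball_le {ν : Measure (Fin d → ℝ)} {D : ℝ≥0∞}
    (hν : IsDoublingWith ν D) (t : Set ((Fin d → ℝ) × ℝ))
    (ht : ∀ b ∈ t, 0 < b.2) (g : (Fin d → ℝ) → ℝ≥0∞)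
    (h : ∀ b ∈ t, ν (ball b.1 b.2) ≤ ∫⁻ y in ball b.1 b.2, g y ∂ν) :
    ν (⋃ b ∈ t, ball b.1 b.2) ≤ D * ∫⁻ y, g y ∂ν := by
  have hU : (⋃ b ∈ t, ball b.1 b.2) = ⋃ n : ℕ, ⋃ b ∈ {b ∈ t | b.2 ≤ n}, ball b.1 b.2 := by
    ext x
    simp only [Set.mem_iUnion, Set.mem_ofPred_eq, exists_prop]
    constructor
    · rintro ⟨b, hb, hx⟩
      obtain ⟨n, hn⟩ := exists_nat_ge b.2
      exact ⟨n, b, ⟨hb, hn⟩, hx⟩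
    · rintro ⟨n, b, ⟨hb, -⟩, hx⟩
      exact ⟨b, hb, hx⟩
  rw [hU, Monotone.measure_iUnion]
  · exact iSup_le fun n => measure_biUnion_ball_le_of_bdd hν _ n (fun b hb => ht b hb.1)
      (fun b hb => hb.2) g fun b hb => h b hb.1
  · intro m n hmn
    refine Set.biUnion_subset_biUnion_left fun b hb => ⟨hb.1, hb.2.trans (by exact_mod_cast hmn)⟩

lemma measure_lt_maxFn_le {ν : Measure (Fin d → ℝ)} {D : ℝ≥0∞} (hν : IsDoublingWith ν D)
    {f : (Fin d → ℝ) → ℝ≥0∞} (hf : Measurable f) {t : ℝ≥0∞} (ht0 : t ≠ 0) (ht : t ≠ ⊤) :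
    ν {x | t < maxFn ν f x} ≤ D * ∫⁻ y, (2 * t⁻¹) * {y | t < 2 * f y}.indicator f y ∂ν := by
  have hms : MeasurableSet {y | t < 2 * f y} := measurableSet_lt measurable_const (by fun_prop)
  have hset : {x | t < maxFn ν f x} ⊆ ⋃ b ∈ {b : (Fin d → ℝ) × ℝ | 0 < b.2 ∧
      t < (∫⁻ y in ball b.1 b.2, f y ∂ν) / ν (ball b.1 b.2)}, ball b.1 b.2 := by
    intro x hx
    obtain ⟨c, r, hxr, h⟩ := lt_maxFn_iff.1 hx
    exact Set.mem_biUnion (x := (c, r)) ⟨pos_of_mem_ball hxr, h⟩ hxr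
  refine (measure_mono hset).trans (measure_biUnion_ball_le hν _ (fun b hb => hb.1) _ ?_)
  rintro ⟨c, r⟩ ⟨hr, h⟩
  simp only at hr h ⊢
  have h0 := hν.pos c r hr
  have h1 := hν.fin c r
  rw [ENNReal.lt_div_iff_mul_lt (Or.inl h0) (Or.inl h1)] at h
  have hpt : ∀ y, 2 * f y ≤ 2 * {y | t < 2 * f y}.indicator f y + t := by
    intro y
    by_cases hy : t < 2 * f y
    · rw [Set.indicator_of_mem (by exact hy)]; exact le_self_add
    · rw [Set.indicator_of_notMem (by exact hy)]; simpa using not_lt.1 hy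
  have hle : 2 * ∫⁻ y in ball c r, f y ∂ν ≤
      2 * (∫⁻ y in ball c r, {y | t < 2 * f y}.indicator f y ∂ν) + t * ν (ball c r) := by
    calc 2 * ∫⁻ y in ball c r, f y ∂ν = ∫⁻ y in ball c r, 2 * f y ∂ν := by
          rw [lintegral_const_mul _ hf]
      _ ≤ ∫⁻ y in ball c r, (2 * {y | t < 2 * f y}.indicator f y + t) ∂ν := lintegral_mono hpt
      _ = _ := by
        rw [lintegral_add_right _ measurable_const, lintegral_const_mul _ (hf.indicator hms)]
        simp
  have htv : t * ν (ball c r) ≠ ⊤ := ENNReal.mul_ne_top ht h1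
  have key : t * ν (ball c r) ≤
      2 * ∫⁻ y in ball c r, {y | t < 2 * f y}.indicator f y ∂ν := by
    have h3 : t * ν (ball c r) + t * ν (ball c r) ≤
        2 * (∫⁻ y in ball c r, {y | t < 2 * f y}.indicator f y ∂ν) + t * ν (ball c r) := by
      refine le_trans ?_ hle
      rw [← two_mul]
      gcongr
    exact (ENNReal.add_le_add_iff_right htv).1 h3
  rw [lintegral_const_mul _ (hf.indicator hms)]
  calc ν (ball c r) = t⁻¹ * (t * ν (ball c r)) := by
        rw [← mul_assoc, ENNReal.inv_mul_cancel ht0 ht, one_mul]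
    _ ≤ t⁻¹ * (2 * ∫⁻ y in ball c r, {y | t < 2 * f y}.indicator f y ∂ν) := by gcongr
    _ = _ := by ring

lemma lintegral_layer {s : ℝ} (hs : 0 < s) (y : ℝ≥0∞) :
    ∫⁻ t in Set.Ioi (0 : ℝ), (if ENNReal.ofReal t < y then ENNReal.ofReal (s * t ^ (s - 1)) else 0)
      = y ^ s := by
  have hfin : ∀ a : ℝ, 0 ≤ a → ∫⁻ t in Set.Ioc (0 : ℝ) a, ENNReal.ofReal (s * t ^ (s - 1))
      = ENNReal.ofReal a ^ s := by
    intro a ha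
    have hint : IntervalIntegrable (fun t : ℝ => s * t ^ (s - 1)) volume 0 a :=
      (intervalIntegral.intervalIntegrable_rpow' (by linarith)).const_mul s
    rw [← ofReal_integral_eq_lintegral_ofReal]
    · rw [← intervalIntegral.integral_of_le ha, intervalIntegral.integral_const_mul,
        integral_rpow (Or.inl (by linarith)), ENNReal.ofReal_rpow_of_nonneg ha hs.le]
      congr 1
      simp [Real.zero_rpow hs.ne']
      field_simp
    · exact (intervalIntegrable_iff_integrableOn_Ioc_of_le ha).1 hint
    · filter_upwards [ae_restrict_mem measurableSet_Ioc] with t ht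
      have := ht.1
      positivity
  induction y with
  | top =>
    rw [ENNReal.top_rpow_of_pos hs, eq_top_iff]
    refine le_of_forall_lt fun b hb => ?_
    obtain ⟨n, hn⟩ := ENNReal.exists_nat_gt (ENNReal.rpow_ne_top_of_nonneg (inv_nonneg.2 hs.le) hb.ne)
    have h1 : b < ENNReal.ofReal n ^ s := by
      have := ENNReal.rpow_lt_rpow hn hs
      rwa [← ENNReal.rpow_mul, inv_mul_cancel₀ hs.ne', ENNReal.rpow_one,
        ← ENNReal.ofReal_natCast] at this
    refine h1.trans_le ?_
    rw [← hfin n (by positivity)]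
    refine (lintegral_mono_set (Set.Ioc_subset_Ioi_self)).trans_eq ?_
    simp
  | coe y =>
    have h2 := hfin y y.2
    rw [ENNReal.ofReal_coe_nnreal, ← restrict_Ioo_eq_restrict_Ioc] at h2
    rw [← h2, ← lintegral_indicator measurableSet_Ioi, ← lintegral_indicator measurableSet_Ioo]
    congr 1
    ext t
    by_cases h : 0 < t
    · have : ENNReal.ofReal t < y ↔ t < y := by
        rw [← ENNReal.ofReal_coe_nnreal, ENNReal.ofReal_lt_ofReal_iff']
        exact ⟨fun h => h.1, fun h' => ⟨h', h.trans h'⟩⟩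
      simp [Set.indicator, h, this]
    · simp [Set.indicator, h]

/-- The maximal function of a doubling measure is bounded on `L^q`, `q > 1`. -/
lemma lintegral_maxFn_rpow_le {ν : Measure (Fin d → ℝ)} [SFinite ν] {D : ℝ≥0∞}
    (hν : IsDoublingWith ν D) {q : ℝ} (hq : 1 < q) :
    ∃ C : ℝ≥0∞, C ≠ ⊤ ∧ ∀ f : (Fin d → ℝ) → ℝ≥0∞, Measurable f →
      ∫⁻ x, maxFn ν f x ^ q ∂ν ≤ C * ∫⁻ x, f x ^ q ∂ν := by
  refine ⟨D * (ENNReal.ofReal (2 * q / (q - 1)) * 2 ^ (q - 1)), ?_, fun f hf => ?_⟩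
  · exact ENNReal.mul_ne_top hν.const_ne_top (ENNReal.mul_ne_top ENNReal.ofReal_ne_top
      (ENNReal.rpow_ne_top_of_nonneg (by linarith) (by simp)))
  have hM := measurable_maxFn ν f
  have hq0 : 0 < q := by linarith
  calc ∫⁻ x, maxFn ν f x ^ q ∂ν
      = ∫⁻ x, (∫⁻ t in Set.Ioi (0 : ℝ), (if ENNReal.ofReal t < maxFn ν f x then
          ENNReal.ofReal (q * t ^ (q - 1)) else 0)) ∂ν := by
        simp_rw [lintegral_layer hq0]
    _ = ∫⁻ t in Set.Ioi (0 : ℝ), ∫⁻ x, (if ENNReal.ofReal t < maxFn ν f x then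
          ENNReal.ofReal (q * t ^ (q - 1)) else 0) ∂ν := by
        rw [lintegral_lintegral_swap]
        refine (Measurable.ite (measurableSet_lt (by fun_prop) (by fun_prop)) (by fun_prop)
          measurable_const).aemeasurable
    _ = ∫⁻ t in Set.Ioi (0 : ℝ), ENNReal.ofReal (q * t ^ (q - 1)) *
          ν {x | ENNReal.ofReal t < maxFn ν f x} := by
        refine lintegral_congr fun t => ?_
        rw [← lintegral_indicator_const (measurableSet_lt measurable_const hM)]
        simp only [Set.indicator, Set.mem_ofPred_eq]
    _ ≤ ∫⁻ t in Set.Ioi (0 : ℝ), D * ∫⁻ x, ENNReal.ofReal (2 * q / (q - 1)) *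
          (f x * (if ENNReal.ofReal t < 2 * f x then
            ENNReal.ofReal ((q - 1) * t ^ (q - 1 - 1)) else 0)) ∂ν := by
        refine setLIntegral_mono' measurableSet_Ioi fun t (ht : 0 < t) => ?_
        have h1 := measure_lt_maxFn_le hν hf (t := ENNReal.ofReal t) (by simpa using ht) (by simp)
        refine (mul_le_mul_right h1 _).trans ?_
        rw [mul_left_comm]
        gcongr
        rw [← lintegral_const_mul']
        swap; · simp
        refine lintegral_mono fun x => ?_
        by_cases hx : ENNReal.ofReal t < 2 * f x
        · rw [Set.indicator_of_mem (by exact hx), if_pos hx]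
          have : ENNReal.ofReal (q * t ^ (q - 1)) * (2 * (ENNReal.ofReal t)⁻¹) =
              ENNReal.ofReal (2 * q / (q - 1)) * ENNReal.ofReal ((q - 1) * t ^ (q - 1 - 1)) := by
            rw [← ENNReal.ofReal_inv_of_pos ht, ← ENNReal.ofReal_mul (by
              have : 0 < q - 1 := by linarith
              positivity),
              show (2 : ℝ≥0∞) = ENNReal.ofReal 2 by simp, ← ENNReal.ofReal_mul (by norm_num),
              ← ENNReal.ofReal_mul (by positivity)]
            congr 1
            rw [Real.rpow_sub_one ht.ne' (q - 1)]
            have : q - 1 ≠ 0 := by linarith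
            field_simp
          rw [← mul_assoc, this]
          exact le_of_eq (by ring)
        · rw [Set.indicator_of_notMem (by exact hx), if_neg hx]
          simp
    _ = D * (ENNReal.ofReal (2 * q / (q - 1)) * ∫⁻ x, (f x * ∫⁻ t in Set.Ioi (0 : ℝ),
          (if ENNReal.ofReal t < 2 * f x then
            ENNReal.ofReal ((q - 1) * t ^ (q - 1 - 1)) else 0)) ∂ν) := by
        have hmeas : Measurable (Function.uncurry fun (t : ℝ) x =>
            (if ENNReal.ofReal t < 2 * f x then
            ENNReal.ofReal ((q - 1) * t ^ (q - 1 - 1)) else 0)) :=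
          Measurable.ite (measurableSet_lt (by fun_prop) (by fun_prop)) (by fun_prop)
            measurable_const
        have hmeas2 : Measurable (Function.uncurry fun (t : ℝ) x =>
            f x * (if ENNReal.ofReal t < 2 * f x then
            ENNReal.ofReal ((q - 1) * t ^ (q - 1 - 1)) else 0)) :=
          (hf.comp measurable_snd).mul hmeas
        rw [lintegral_const_mul' _ _ hν.const_ne_top]
        simp_rw [lintegral_const_mul' _ _ ENNReal.ofReal_ne_top]
        rw [lintegral_lintegral_swap hmeas2.aemeasurable]
        congr 3
        ext x
        exact lintegral_const_mul _ (hmeas.comp (measurable_id.prodMk measurable_const))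
    _ = D * (ENNReal.ofReal (2 * q / (q - 1)) * ∫⁻ x, 2 ^ (q - 1) * f x ^ q ∂ν) := by
        congr 3
        ext x
        rw [lintegral_layer (by linarith), ENNReal.mul_rpow_of_nonneg _ _ (by linarith),
          mul_left_comm]
        congr 1
        nth_rewrite 1 [← ENNReal.rpow_one (f x)]
        rw [← ENNReal.rpow_add_of_nonneg _ _ zero_le_one (by linarith)]
        congr 1; ring
    _ = _ := by
        rw [lintegral_const_mul' _ _ (ENNReal.rpow_ne_top_of_nonneg (by linarith) (by simp))]
        ring

end MaximalFunction

section RecipNorm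

/-! ### Lebesgue norms indexed by the reciprocal exponent -/

open Classical in
/-- The `L^{1/b}` norm with respect to `μ`, with the `L^∞` norm when `b = 0`. -/
def recipNorm {α : Type*} [MeasurableSpace α] (μ : Measure α) (b : ℝ) (u : α → ℝ≥0∞) : ℝ≥0∞ :=
  if b = 0 then essSup u μ else (∫⁻ x, u x ^ (1 / b) ∂μ) ^ b

section recipNorm

variable {α : Type*} [MeasurableSpace α] {μ : Measure α} {b c t : ℝ} {u v : α → ℝ≥0∞}

lemma recipNorm_zero : recipNorm μ 0 u = essSup u μ := if_pos rfl

lemma recipNorm_of_ne (hb : b ≠ 0) : recipNorm μ b u = (∫⁻ x, u x ^ (1 / b) ∂μ) ^ b := if_neg hb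

lemma recipNorm_one_eq : recipNorm μ 1 u = ∫⁻ x, u x ∂μ := by
  simp [recipNorm_of_ne one_ne_zero]

lemma recipNorm_congr_ae (h : u =ᵐ[μ] v) : recipNorm μ b u = recipNorm μ b v := by
  by_cases hb : b = 0
  · rw [hb, recipNorm_zero, recipNorm_zero, essSup_congr_ae h]
  · rw [recipNorm_of_ne hb, recipNorm_of_ne hb]
    congr 1
    exact lintegral_congr_ae (h.mono fun x hx => by simp [hx])

lemma recipNorm_rpow (ht : 0 < t) :
    recipNorm μ b (fun x => u x ^ t) = recipNorm μ (b / t) u ^ t := by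
  by_cases hb : b = 0
  · rw [hb, zero_div, recipNorm_zero, recipNorm_zero]
    exact ((ENNReal.orderIsoRpow t ht).essSup_apply u μ).symm
  · have hbt : b / t ≠ 0 := div_ne_zero hb ht.ne'
    rw [recipNorm_of_ne hb, recipNorm_of_ne hbt, ← ENNReal.rpow_mul, div_mul_cancel₀ _ ht.ne']
    congr 2
    ext x
    rw [← ENNReal.rpow_mul]
    congr 1
    field_simp

lemma recipNorm_one [IsProbabilityMeasure μ] : recipNorm μ b (fun _ => 1) = 1 := by
  by_cases hb : b = 0
  · rw [hb, recipNorm_zero, essSup_const _ (IsProbabilityMeasure.ne_zero μ)]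
  · simp [recipNorm_of_ne hb]

lemma recipNorm_mul_le_of_zero (hc : 0 ≤ c) (hv : AEMeasurable v μ) :
    recipNorm μ c (fun x => u x * v x) ≤ recipNorm μ 0 u * recipNorm μ c v := by
  rcases hc.eq_or_lt with rfl | hc
  · simp only [recipNorm_zero]
    exact ENNReal.essSup_mul_le u v
  · rw [recipNorm_zero, recipNorm_of_ne hc.ne', recipNorm_of_ne hc.ne']
    by_cases h0 : essSup u μ = 0
    · have : ∫⁻ x, (u x * v x) ^ (1 / c) ∂μ = 0 := by
        rw [lintegral_eq_zero_of_ae_eq_zero]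
        rw [ENNReal.essSup_eq_zero_iff] at h0
        filter_upwards [h0] with x hx
        simp [hx, hc]
      rw [this, ENNReal.zero_rpow_of_pos hc]
      exact bot_le
    by_cases htop : essSup u μ = ⊤
    · by_cases h1 : (∫⁻ x, v x ^ (1 / c) ∂μ) ^ c = 0
      · have h2 : ∫⁻ x, (u x * v x) ^ (1 / c) ∂μ = 0 := by
          rw [ENNReal.rpow_eq_zero_iff_of_pos hc,
            lintegral_eq_zero_iff' (hv.pow_const _)] at h1
          rw [lintegral_eq_zero_of_ae_eq_zero]
          filter_upwards [h1] with x hx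
          have hx : v x = 0 := by simpa [hc, hc.not_gt] using hx
          simp [hx, hc]
        rw [h2, ENNReal.zero_rpow_of_pos hc]
        exact bot_le
      · rw [htop, ENNReal.top_mul h1]; exact le_top
    calc (∫⁻ x, (u x * v x) ^ (1 / c) ∂μ) ^ c
        ≤ (∫⁻ x, essSup u μ ^ (1 / c) * v x ^ (1 / c) ∂μ) ^ c := by
          gcongr ?_ ^ c
          refine lintegral_mono_ae ?_
          filter_upwards [ENNReal.ae_le_essSup u] with x hx
          rw [← ENNReal.mul_rpow_of_nonneg _ _ (by positivity)]
          gcongr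
      _ = _ := by
          rw [lintegral_const_mul' _ _ (ENNReal.rpow_ne_top_of_nonneg (by positivity) htop),
            ENNReal.mul_rpow_of_nonneg _ _ hc.le, ← ENNReal.rpow_mul, one_div_mul_cancel hc.ne',
            ENNReal.rpow_one]

lemma recipNorm_mul_le (hb : 0 ≤ b) (hc : 0 ≤ c) (hu : AEMeasurable u μ) (hv : AEMeasurable v μ) :
    recipNorm μ (b + c) (fun x => u x * v x) ≤ recipNorm μ b u * recipNorm μ c v := by
  rcases hb.eq_or_lt with rfl | hb
  · rw [zero_add]; exact recipNorm_mul_le_of_zero hc hv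
  rcases hc.eq_or_lt with rfl | hc
  · rw [add_zero, mul_comm]
    simp_rw [mul_comm (u _)]
    exact recipNorm_mul_le_of_zero hb.le hu
  · rw [recipNorm_of_ne hb.ne', recipNorm_of_ne hc.ne', recipNorm_of_ne (by positivity)]
    have := ENNReal.lintegral_Lp_mul_le_Lq_mul_Lr (p := 1 / (b + c)) (q := 1 / b) (r := 1 / c)
      (by positivity) (one_div_lt_one_div_of_lt hb (by linarith)) (by simp) μ hu hv
    simpa only [one_div_one_div, Pi.mul_apply] using this

lemma recipNorm_le_recipNorm [IsProbabilityMeasure μ] (hb : 0 ≤ b) (hbc : b ≤ c)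
    (hu : AEMeasurable u μ) : recipNorm μ c u ≤ recipNorm μ b u := by
  have := recipNorm_mul_le (μ := μ) hb (sub_nonneg.2 hbc) hu (v := fun _ => 1) aemeasurable_const
  simpa [recipNorm_one] using this

lemma one_le_recipNorm_mul_inv [IsProbabilityMeasure μ] (hb : 0 ≤ b) (hc : 0 ≤ c)
    (hu : AEMeasurable u μ) (h0 : ∀ᵐ x ∂μ, u x ≠ 0 ∧ u x ≠ ⊤) :
    1 ≤ recipNorm μ b u * recipNorm μ c (fun x => (u x)⁻¹) := by
  refine le_trans ?_ (recipNorm_mul_le hb hc hu hu.inv)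
  rw [recipNorm_congr_ae (v := fun _ => 1), recipNorm_one]
  filter_upwards [h0] with x hx
  exact ENNReal.mul_inv_cancel hx.1 hx.2

end recipNorm

end RecipNorm

section ExponentClass

variable {d : ℕ}

/-! ### Two-exponent Muckenhoupt classes -/

/-- The normalised Lebesgue measure on a ball. -/
def ballAvg (c : Fin d → ℝ) (r : ℝ) : Measure (Fin d → ℝ) :=
  (volume (ball c r))⁻¹ • volume.restrict (ball c r)

lemma volume_ball_ne_zero (c : Fin d → ℝ) {r : ℝ} (hr : 0 < r) : volume (ball c r) ≠ 0 :=
  (measure_ball_pos volume c hr).ne'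

lemma volume_ball_ne_top (c : Fin d → ℝ) (r : ℝ) : volume (ball c r) ≠ ⊤ :=
  measure_ball_lt_top.ne

lemma lintegral_ballAvg (c : Fin d → ℝ) (r : ℝ) (f : (Fin d → ℝ) → ℝ≥0∞) :
    ∫⁻ x, f x ∂ballAvg c r = (∫⁻ x in ball c r, f x) / volume (ball c r) := by
  rw [ballAvg, lintegral_smul_measure, smul_eq_mul, mul_comm, div_eq_mul_inv]

lemma isProbabilityMeasure_ballAvg (c : Fin d → ℝ) {r : ℝ} (hr : 0 < r) :
    IsProbabilityMeasure (ballAvg c r) := by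
  constructor
  rw [ballAvg, Measure.smul_apply, Measure.restrict_apply_univ, smul_eq_mul,
    ENNReal.inv_mul_cancel (volume_ball_ne_zero c hr) (volume_ball_ne_top c r)]

lemma ballAvg_absolutelyContinuous (c : Fin d → ℝ) (r : ℝ) :
    ballAvg c r ≪ volume.restrict (ball c r) :=
  Measure.smul_absolutelyContinuous

lemma ae_ballAvg_of_ae {p : (Fin d → ℝ) → Prop} (h : ∀ᵐ x, p x) (c : Fin d → ℝ) (r : ℝ) :
    ∀ᵐ x ∂ballAvg c r, p x :=
  (ballAvg_absolutelyContinuous c r).ae_le (ae_restrict_of_ae h)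

lemma volume_ball_mul (c c' : Fin d → ℝ) {t r : ℝ} (ht : 0 < t) (hr : 0 < r) :
    volume (ball c (t * r)) = ENNReal.ofReal t ^ d * volume (ball c' r) := by
  rw [Real.volume_pi_ball _ hr, Real.volume_pi_ball _ (by positivity),
    show 2 * (t * r) = t * (2 * r) by ring, mul_pow, ENNReal.ofReal_mul (by positivity),
    ENNReal.ofReal_pow ht.le]
  simp

/-- `InClass b a v`: the function `v` is a positive measurable function for which the product of
the averaged `L^{1/b}` norm of `v` and the averaged `L^{1/a}` norm of `v⁻¹` is bounded uniformly
over balls. -/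
structure InClass (b a : ℝ) (v : (Fin d → ℝ) → ℝ≥0∞) : Prop where
  meas : Measurable v
  ne_zero : ∀ x, v x ≠ 0
  ne_top : ∀ x, v x ≠ ⊤
  bound : ∃ C : ℝ≥0∞, C ≠ ⊤ ∧ ∀ c r, 0 < r →
    recipNorm (ballAvg c r) b v * recipNorm (ballAvg c r) a (fun x => (v x)⁻¹) ≤ C

namespace InClass

variable {b a : ℝ} {v : (Fin d → ℝ) → ℝ≥0∞}

lemma symm (h : InClass b a v) : InClass a b fun x => (v x)⁻¹ where
  meas := h.meas.inv
  ne_zero x := ENNReal.inv_ne_zero.2 (h.ne_top x)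
  ne_top x := ENNReal.inv_ne_top.2 (h.ne_zero x)
  bound := by
    obtain ⟨C, hC, hb⟩ := h.bound
    refine ⟨C, hC, fun c r hr => ?_⟩
    simp only [inv_inv]
    rw [mul_comm]
    exact hb c r hr

lemma one_le (h : InClass b a v) {s t : ℝ} (hs : 0 ≤ s) (ht : 0 ≤ t) (c : Fin d → ℝ) {r : ℝ}
    (hr : 0 < r) :
    1 ≤ recipNorm (ballAvg c r) s v * recipNorm (ballAvg c r) t (fun x => (v x)⁻¹) := by
  have := isProbabilityMeasure_ballAvg c hr
  exact one_le_recipNorm_mul_inv hs ht h.meas.aemeasurable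
    (ae_of_all _ fun x => ⟨h.ne_zero x, h.ne_top x⟩)

lemma recipNorm_ne_zero (h : InClass b a v) {s : ℝ} (hs : 0 ≤ s) (c : Fin d → ℝ) {r : ℝ}
    (hr : 0 < r) : recipNorm (ballAvg c r) s v ≠ 0 := by
  intro h0
  have := h.one_le hs zero_le_one c hr
  simp [h0] at this

lemma recipNorm_ne_top (h : InClass b a v) (ha : 0 ≤ a) (c : Fin d → ℝ) {r : ℝ}
    (hr : 0 < r) : recipNorm (ballAvg c r) b v ≠ ⊤ := by
  intro h0
  obtain ⟨C, hC, hb⟩ := h.bound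
  have := hb c r hr
  rw [h0, ENNReal.top_mul (h.symm.recipNorm_ne_zero ha c hr)] at this
  exact hC (top_le_iff.1 this)

lemma withDensity_ball (hb : 0 < b) (c : Fin d → ℝ) {r : ℝ} (hr : 0 < r) :
    (volume.withDensity fun x => v x ^ (1 / b)) (ball c r) =
      volume (ball c r) * recipNorm (ballAvg c r) b v ^ (1 / b) := by
  rw [withDensity_apply _ measurableSet_ball, recipNorm_of_ne hb.ne', ← ENNReal.rpow_mul,
    mul_one_div_cancel hb.ne', ENNReal.rpow_one, lintegral_ballAvg,
    ENNReal.mul_div_cancel (volume_ball_ne_zero c hr) (volume_ball_ne_top c r)]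

lemma exists_isDoublingWith (h : InClass b a v) (hb : 0 < b) (ha : 0 < a) :
    ∃ D, IsDoublingWith (volume.withDensity fun x => v x ^ (1 / b)) D := by
  obtain ⟨C, hC, hbd⟩ := h.bound
  set k : ℝ≥0∞ := (5 ^ d) ^ a with hk
  have hktop : k ≠ ⊤ := ENNReal.rpow_ne_top_of_nonneg ha.le (by simp)
  refine ⟨5 ^ d * (k * C) ^ (1 / b), fun c r hr => ?_, fun c r => ?_, ?_, fun c r hr => ?_⟩
  · rw [withDensity_ball hb c hr]
    refine mul_ne_zero (volume_ball_ne_zero c hr) ?_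
    have := h.recipNorm_ne_zero hb.le c hr
    simp [this, hb, hb.not_gt]
  · rcases le_or_gt r 0 with hr | hr
    · simp [ball_eq_empty.2 hr]
    rw [withDensity_ball hb c hr]
    exact ENNReal.mul_ne_top (volume_ball_ne_top c r)
      (ENNReal.rpow_ne_top_of_nonneg (by positivity) (h.recipNorm_ne_top ha.le c hr))
  · exact ENNReal.mul_ne_top (by simp) (ENNReal.rpow_ne_top_of_nonneg (by positivity)
      (ENNReal.mul_ne_top hktop hC))
  · have h5r : 0 < 5 * r := by positivity
    have hS : recipNorm (ballAvg c r) a (fun x => (v x)⁻¹) ≤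
        k * recipNorm (ballAvg c (5 * r)) a (fun x => (v x)⁻¹) := by
      rw [recipNorm_of_ne ha.ne', recipNorm_of_ne ha.ne', hk,
        ← ENNReal.mul_rpow_of_nonneg _ _ ha.le]
      gcongr
      rw [lintegral_ballAvg, lintegral_ballAvg, volume_ball_mul c c (t := 5) (by norm_num) hr, ENNReal.ofReal_ofNat]
      rw [ENNReal.div_le_iff (volume_ball_ne_zero c hr) (volume_ball_ne_top c r), mul_right_comm,
        ENNReal.mul_div_cancel]
      · exact lintegral_mono_set (ball_subset_ball (by linarith))
      · exact mul_ne_zero (by simp) (volume_ball_ne_zero c hr)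
      · exact ENNReal.mul_ne_top (by simp) (volume_ball_ne_top c r)
    rw [withDensity_ball hb c hr, withDensity_ball hb c h5r,
      volume_ball_mul c c (t := 5) (by norm_num) hr, ENNReal.ofReal_ofNat]
    have key : recipNorm (ballAvg c (5 * r)) b v ≤ k * C * recipNorm (ballAvg c r) b v := by
      calc recipNorm (ballAvg c (5 * r)) b v
          ≤ recipNorm (ballAvg c (5 * r)) b v * (recipNorm (ballAvg c r) b v *
            recipNorm (ballAvg c r) a (fun x => (v x)⁻¹)) :=
              le_mul_of_one_le_right' (h.one_le hb.le ha.le c hr)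
        _ ≤ recipNorm (ballAvg c (5 * r)) b v * (recipNorm (ballAvg c r) b v *
            (k * recipNorm (ballAvg c (5 * r)) a (fun x => (v x)⁻¹))) := by gcongr
        _ = k * (recipNorm (ballAvg c (5 * r)) b v *
            recipNorm (ballAvg c (5 * r)) a (fun x => (v x)⁻¹)) * recipNorm (ballAvg c r) b v := by
              ring
        _ ≤ _ := by gcongr; exact hbd c _ h5r
    calc 5 ^ d * volume (ball c r) * recipNorm (ballAvg c (5 * r)) b v ^ (1 / b)
        ≤ 5 ^ d * volume (ball c r) * (k * C * recipNorm (ballAvg c r) b v) ^ (1 / b) := by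
          gcongr
      _ = _ := by
          rw [ENNReal.mul_rpow_of_nonneg (k * C) _ (by positivity)]
          ring

/-- **Muckenhoupt's theorem**: the Hardy-Littlewood maximal function is bounded on the weighted
space `L^{(a+b)/b}(v^{1/b})`. -/
lemma lintegral_maxFn_volume_le (h : InClass b a v) (hb : 0 < b) (ha : 0 < a) :
    ∃ K : ℝ≥0∞, K ≠ ⊤ ∧ ∀ f : (Fin d → ℝ) → ℝ≥0∞, Measurable f →
      ∫⁻ x, maxFn volume f x ^ ((a + b) / b) * v x ^ (1 / b) ≤
        K * ∫⁻ x, f x ^ ((a + b) / b) * v x ^ (1 / b) := by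
  set A : (Fin d → ℝ) → ℝ≥0∞ := fun x => v x ^ (1 / b) with hA
  set S : (Fin d → ℝ) → ℝ≥0∞ := fun x => (v x)⁻¹ ^ (1 / a) with hS
  have hv := h.meas
  have hAm : Measurable A := by fun_prop
  have hSm : Measurable S := by fun_prop
  have hSx : ∀ x, S x = v x ^ (-(1 / a)) := fun x => by
    simp only [hS]; rw [ENNReal.inv_rpow, ENNReal.rpow_neg]
  have hpow0 : ∀ (x) (s : ℝ), v x ^ s ≠ 0 := fun x s => by
    simp [h.ne_zero x, h.ne_top x]
  have hpowt : ∀ (x) (s : ℝ), v x ^ s ≠ ⊤ := fun x s => by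
    simp [h.ne_zero x, h.ne_top x]
  obtain ⟨C, hC, hbd⟩ := h.bound
  obtain ⟨DA, hDA⟩ := h.exists_isDoublingWith hb ha
  obtain ⟨DS, hDS⟩ := h.symm.exists_isDoublingWith ha hb
  set νA := volume.withDensity A with hνA
  set νS := volume.withDensity S with hνS
  obtain ⟨KA, hKA, hMA⟩ := lintegral_maxFn_rpow_le hDA (q := (a + b) / a)
    (by rw [lt_div_iff₀ ha]; linarith)
  obtain ⟨KS, hKS, hMS⟩ := lintegral_maxFn_rpow_le hDS (q := (a + b) / b)
    (by rw [lt_div_iff₀ hb]; linarith)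
  refine ⟨C ^ (1 / a * ((a + b) / b)) * (KA * KS), ?_, fun f hf => ?_⟩
  · exact ENNReal.mul_ne_top (ENNReal.rpow_ne_top_of_nonneg (by positivity) hC)
      (ENNReal.mul_ne_top hKA hKS)
  set g : (Fin d → ℝ) → ℝ≥0∞ := fun x => f x * (S x)⁻¹ with hg
  have hgm : Measurable g := by fun_prop
  have hMgm := measurable_maxFn νS g
  set Φ : (Fin d → ℝ) → ℝ≥0∞ := fun z => maxFn νS g z ^ (a / b) * (A z)⁻¹ with hΦ
  have hΦm : Measurable Φ := by fun_prop
  have hpt : ∀ x, maxFn volume f x ≤ C ^ (1 / a) * maxFn νA Φ x ^ (b / a) := by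
    intro x
    refine iSup_le fun c => iSup_le fun r => iSup_le fun hx => ?_
    have hr := pos_of_mem_ball hx
    have hB0 := volume_ball_ne_zero c hr
    have hBt := volume_ball_ne_top c r
    have hSB := hDS.pos c r hr
    have hSBt := hDS.fin c r
    have hAB := hDA.pos c r hr
    have hABt := hDA.fin c r
    have hfg : ∫⁻ y in ball c r, f y = ∫⁻ y in ball c r, g y ∂νS := by
      rw [hνS, setLIntegral_withDensity_eq_setLIntegral_mul _ hSm hgm measurableSet_ball]
      refine lintegral_congr fun y => ?_
      simp only [hg, Pi.mul_apply]
      rw [mul_left_comm, ENNReal.mul_inv_cancel (by rw [hSx]; exact hpow0 y _)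
        (by rw [hSx]; exact hpowt y _), mul_one]
    set m : ℝ≥0∞ := (∫⁻ y in ball c r, g y ∂νS) / νS (ball c r) with hm
    have h1 : m ^ (a / b) * (volume (ball c r) / νA (ball c r)) ≤ maxFn νA Φ x := by
      refine le_trans ?_ (le_maxFn νA Φ hx)
      rw [← mul_div_assoc]
      gcongr
      calc m ^ (a / b) * volume (ball c r) = ∫⁻ y in ball c r, m ^ (a / b) * (A y)⁻¹ ∂νA := by
            rw [hνA, setLIntegral_withDensity_eq_setLIntegral_mul _ hAm (by fun_prop)
              measurableSet_ball, ← setLIntegral_const]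
            refine lintegral_congr fun y => ?_
            simp only [Pi.mul_apply]
            rw [mul_left_comm, ENNReal.mul_inv_cancel (hpow0 y _) (hpowt y _), mul_one]
        _ ≤ _ := by
            refine setLIntegral_mono' measurableSet_ball fun y hy => ?_
            simp only [hΦ]
            gcongr
            exact le_maxFn νS g hy
    have h2 : νS (ball c r) / volume (ball c r) ≤
        C ^ (1 / a) * (volume (ball c r) / νA (ball c r)) ^ (b / a) := by
      have e1 : νA (ball c r) / volume (ball c r) = recipNorm (ballAvg c r) b v ^ (1 / b) := by
        rw [hνA, withDensity_ball hb c hr, mul_comm, ENNReal.mul_div_cancel_right hB0 hBt]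
      have e2 : νS (ball c r) / volume (ball c r) =
          recipNorm (ballAvg c r) a (fun x => (v x)⁻¹) ^ (1 / a) := by
        rw [hνS, hS, withDensity_ball (v := fun x => (v x)⁻¹) ha c hr, mul_comm, ENNReal.mul_div_cancel_right hB0 hBt]
      have e3 : (volume (ball c r) / νA (ball c r)) ^ (b / a) =
          (recipNorm (ballAvg c r) b v ^ (1 / a))⁻¹ := by
        rw [← ENNReal.inv_div (Or.inl hBt) (Or.inl hB0), e1, ENNReal.inv_rpow, ← ENNReal.rpow_mul]
        congr 2
        field_simp
      have n0 : recipNorm (ballAvg c r) b v ^ (1 / a) ≠ 0 := by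
        have := h.recipNorm_ne_zero hb.le c hr
        simp [this, ha, ha.not_gt]
      have nt : recipNorm (ballAvg c r) b v ^ (1 / a) ≠ ⊤ :=
        ENNReal.rpow_ne_top_of_nonneg (by positivity) (h.recipNorm_ne_top ha.le c hr)
      rw [e2, e3, ← div_eq_mul_inv, ENNReal.le_div_iff_mul_le (Or.inl n0) (Or.inl nt),
        ← ENNReal.mul_rpow_of_nonneg _ _ (by positivity), mul_comm]
      gcongr
      exact hbd c r hr
    calc (∫⁻ y in ball c r, f y) / volume (ball c r)
        = m * (νS (ball c r) / volume (ball c r)) := by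
          rw [hfg, hm, ← mul_div_assoc, ENNReal.div_mul_cancel hSB hSBt]
      _ ≤ m * (C ^ (1 / a) * (volume (ball c r) / νA (ball c r)) ^ (b / a)) := by gcongr
      _ = C ^ (1 / a) * (m ^ (a / b) * (volume (ball c r) / νA (ball c r))) ^ (b / a) := by
          rw [ENNReal.mul_rpow_of_nonneg _ _ (by positivity), ← ENNReal.rpow_mul,
            div_mul_div_cancel₀ hb.ne', div_self ha.ne', ENNReal.rpow_one]
          ring
      _ ≤ _ := by gcongr
  have hτ : 0 < (a + b) / b := by positivity
  calc ∫⁻ x, maxFn volume f x ^ ((a + b) / b) * A x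
      ≤ ∫⁻ x, C ^ (1 / a * ((a + b) / b)) * (A x * maxFn νA Φ x ^ ((a + b) / a)) := by
        refine lintegral_mono fun x => ?_
        calc maxFn volume f x ^ ((a + b) / b) * A x
            ≤ (C ^ (1 / a) * maxFn νA Φ x ^ (b / a)) ^ ((a + b) / b) * A x := by
              gcongr; exact hpt x
          _ = _ := by
              rw [ENNReal.mul_rpow_of_nonneg _ _ hτ.le, ← ENNReal.rpow_mul, ← ENNReal.rpow_mul,
                show b / a * ((a + b) / b) = (a + b) / a by field_simp]
              ring
    _ = C ^ (1 / a * ((a + b) / b)) * ∫⁻ x, maxFn νA Φ x ^ ((a + b) / a) ∂νA := by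
        rw [lintegral_const_mul' _ _ (ENNReal.rpow_ne_top_of_nonneg (by positivity) hC), hνA,
          lintegral_withDensity_eq_lintegral_mul _ hAm ((measurable_maxFn _ Φ).pow_const _)]
        rfl
    _ ≤ C ^ (1 / a * ((a + b) / b)) * (KA * ∫⁻ x, Φ x ^ ((a + b) / a) ∂νA) := by
        gcongr; exact hMA Φ hΦm
    _ = C ^ (1 / a * ((a + b) / b)) * (KA * ∫⁻ x, maxFn νS g x ^ ((a + b) / b) ∂νS) := by
        rw [hνA, lintegral_withDensity_eq_lintegral_mul _ hAm (hΦm.pow_const _), hνS,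
          lintegral_withDensity_eq_lintegral_mul _ hSm (hMgm.pow_const _)]
        congr 3
        ext x
        simp only [Pi.mul_apply, hΦ]
        rw [ENNReal.mul_rpow_of_nonneg _ _ (by positivity), ← ENNReal.rpow_mul, hSx,
          show a / b * ((a + b) / a) = (a + b) / b by field_simp, mul_left_comm, mul_comm]
        congr 1
        simp only [hA]
        rw [← ENNReal.rpow_neg, ← ENNReal.rpow_mul, ← ENNReal.rpow_add _ _ (h.ne_zero x)
          (h.ne_top x)]
        congr 1
        field_simp
        ring
    _ ≤ C ^ (1 / a * ((a + b) / b)) * (KA * (KS * ∫⁻ x, g x ^ ((a + b) / b) ∂νS)) := by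
        gcongr; exact hMS g hgm
    _ = C ^ (1 / a * ((a + b) / b)) * (KA * (KS * ∫⁻ x, f x ^ ((a + b) / b) * A x)) := by
        rw [hνS, lintegral_withDensity_eq_lintegral_mul _ hSm (hgm.pow_const _)]
        congr 4
        ext x
        simp only [Pi.mul_apply, hg]
        rw [ENNReal.mul_rpow_of_nonneg _ _ (by positivity), mul_left_comm, hSx]
        congr 1
        simp only [hA]
        rw [← ENNReal.rpow_neg, ← ENNReal.rpow_mul, ← ENNReal.rpow_add _ _ (h.ne_zero x)
          (h.ne_top x)]
        congr 1
        field_simp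
        ring
    _ = _ := by ring

end InClass

end ExponentClass

section RubioDeFrancia

/-! ### The Rubio de Francia algorithm -/

lemma tsum_two_inv_pow_mul_rpow_le {τ : ℝ} (hτ : 0 < τ) (y : ℕ → ℝ≥0∞) :
    (∑' k, (2⁻¹ : ℝ≥0∞) ^ k * y k) ^ τ ≤ 2 ^ τ * ∑' k, y k ^ τ := by
  have h1 : ∑' k, (2⁻¹ : ℝ≥0∞) ^ k * y k ≤ 2 * ⨆ k, y k := by
    calc ∑' k, (2⁻¹ : ℝ≥0∞) ^ k * y k ≤ ∑' k, (2⁻¹ : ℝ≥0∞) ^ k * ⨆ k, y k := by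
          gcongr with k; exact le_iSup y k
      _ = _ := by rw [ENNReal.tsum_mul_right, ENNReal.tsum_geometric_two]
  have h2 : (⨆ k, y k) ^ τ ≤ ∑' k, y k ^ τ := by
    have := (ENNReal.orderIsoRpow τ hτ).map_iSup y
    simp only [ENNReal.orderIsoRpow_apply] at this
    rw [this]
    exact iSup_le fun k => ENNReal.le_tsum k
  calc _ ≤ (2 * ⨆ k, y k) ^ τ := by gcongr
    _ = 2 ^ τ * (⨆ k, y k) ^ τ := ENNReal.mul_rpow_of_nonneg _ _ hτ.le
    _ ≤ _ := by gcongr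

variable {d : ℕ}

/-- The Rubio de Francia iteration: a function has an `A₁` majorant of comparable norm in any
weighted space on which the maximal function is bounded. -/
lemma exists_ge_average_le {A : (Fin d → ℝ) → ℝ≥0∞} (hA : Measurable A) {τ : ℝ} (hτ : 1 ≤ τ)
    {K : ℝ≥0∞} (hK : K ≠ ⊤)
    (hM : ∀ f : (Fin d → ℝ) → ℝ≥0∞, Measurable f →
      ∫⁻ x, maxFn volume f x ^ τ * A x ≤ K * ∫⁻ x, f x ^ τ * A x)
    {P₀ : (Fin d → ℝ) → ℝ≥0∞} (hP₀ : Measurable P₀) (hfin : ∫⁻ x, P₀ x ^ τ * A x ≠ ⊤) :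
    ∃ P : (Fin d → ℝ) → ℝ≥0∞, Measurable P ∧ P₀ ≤ P ∧ ∫⁻ x, P x ^ τ * A x ≠ ⊤ ∧
      ∃ C : ℝ≥0∞, C ≠ ⊤ ∧ ∀ c r, ∀ x ∈ ball c r,
        (∫⁻ y in ball c r, P y) / volume (ball c r) ≤ C * P x := by
  have hτ0 : 0 < τ := by linarith
  set L : ℝ≥0∞ := (K + 1) ^ (1 / τ) with hL
  have hLτ : L ^ τ = K + 1 := by
    rw [hL, ← ENNReal.rpow_mul, one_div_mul_cancel hτ0.ne', ENNReal.rpow_one]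
  have hLt : L ≠ ⊤ := ENNReal.rpow_ne_top_of_nonneg (by positivity) (by simp [hK])
  have hL0 : L ≠ 0 := by
    intro h0
    rw [h0, ENNReal.zero_rpow_of_pos hτ0] at hLτ
    exact (zero_lt_one.trans_le le_add_self).ne hLτ
  set M : ℕ → (Fin d → ℝ) → ℝ≥0∞ := fun k => (maxFn volume)^[k] P₀ with hMdef
  have hMs : ∀ k, M (k + 1) = maxFn volume (M k) := fun k => by
    simp only [hMdef, Function.iterate_succ_apply']
  have hMm : ∀ k, Measurable (M k) := by
    intro k
    cases k with
    | zero => exact hP₀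
    | succ k => rw [hMs]; exact measurable_maxFn _ _
  have hMi : ∀ k, ∫⁻ x, M k x ^ τ * A x ≤ (L ^ k) ^ τ * ∫⁻ x, P₀ x ^ τ * A x := by
    intro k
    induction k with
    | zero => simp [hMdef]
    | succ k ih =>
      rw [hMs]
      calc _ ≤ K * ∫⁻ x, M k x ^ τ * A x := hM _ (hMm k)
        _ ≤ L ^ τ * ((L ^ k) ^ τ * ∫⁻ x, P₀ x ^ τ * A x) := by
            gcongr; rw [hLτ]; exact le_self_add
        _ = _ := by rw [pow_succ, ENNReal.mul_rpow_of_nonneg _ _ hτ0.le]; ring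
  set P : (Fin d → ℝ) → ℝ≥0∞ := fun x =>
    ∑' k, (2⁻¹ : ℝ≥0∞) ^ k * ((2⁻¹ : ℝ≥0∞) ^ k * (L⁻¹ ^ k * M k x)) with hP
  refine ⟨P, ?_, ?_, ?_, 4 * L, ENNReal.mul_ne_top (by simp) hLt, ?_⟩
  · exact Measurable.tsum fun k =>
      (((hMm k).const_mul _).const_mul _).const_mul _
  · intro x
    refine le_trans ?_ (ENNReal.le_tsum 0)
    simp [hMdef]
  · refine ne_top_of_le_ne_top ?_ (b := 2 ^ τ * (2 * ∫⁻ x, P₀ x ^ τ * A x)) ?_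
    · exact ENNReal.mul_ne_top (by simp) (ENNReal.mul_ne_top (by simp) hfin)
    calc ∫⁻ x, P x ^ τ * A x
        ≤ ∫⁻ x, 2 ^ τ * ∑' k, ((2⁻¹ : ℝ≥0∞) ^ k * (L⁻¹ ^ k * M k x)) ^ τ * A x := by
          refine lintegral_mono fun x => ?_
          rw [ENNReal.tsum_mul_right, ← mul_assoc]
          gcongr
          exact tsum_two_inv_pow_mul_rpow_le hτ0 _
      _ = 2 ^ τ * ∑' k, ∫⁻ x, ((2⁻¹ : ℝ≥0∞) ^ k * (L⁻¹ ^ k * M k x)) ^ τ * A x := by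
          rw [lintegral_const_mul' _ _ (by simp), lintegral_tsum]
          intro k
          exact (((((hMm k).const_mul _).const_mul _).pow_const _).mul hA).aemeasurable
      _ ≤ 2 ^ τ * ∑' k : ℕ, (2⁻¹ : ℝ≥0∞) ^ k * ∫⁻ x, P₀ x ^ τ * A x := by
          gcongr with k
          have hLk : (L ^ k)⁻¹ * L ^ k = 1 :=
            ENNReal.inv_mul_cancel (pow_ne_zero _ hL0) (ENNReal.pow_ne_top hLt)
          calc ∫⁻ x, ((2⁻¹ : ℝ≥0∞) ^ k * (L⁻¹ ^ k * M k x)) ^ τ * A x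
              = ((2⁻¹ : ℝ≥0∞) ^ k * L⁻¹ ^ k) ^ τ * ∫⁻ x, M k x ^ τ * A x := by
                rw [← lintegral_const_mul' _ _ (ENNReal.rpow_ne_top_of_nonneg hτ0.le
                  (ENNReal.mul_ne_top (by simp) (by simp [hL0])))]
                refine lintegral_congr fun x => ?_
                rw [← mul_assoc, ENNReal.mul_rpow_of_nonneg _ _ hτ0.le, mul_assoc]
            _ ≤ ((2⁻¹ : ℝ≥0∞) ^ k * L⁻¹ ^ k) ^ τ * ((L ^ k) ^ τ * ∫⁻ x, P₀ x ^ τ * A x) := by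
                gcongr; exact hMi k
            _ = ((2⁻¹ : ℝ≥0∞) ^ k) ^ τ * ∫⁻ x, P₀ x ^ τ * A x := by
                rw [← mul_assoc, ← ENNReal.mul_rpow_of_nonneg _ _ hτ0.le, mul_assoc,
                  ← ENNReal.inv_pow (a := L), hLk, mul_one]
            _ ≤ ((2⁻¹ : ℝ≥0∞) ^ k) ^ (1 : ℝ) * ∫⁻ x, P₀ x ^ τ * A x := by
                gcongr ?_ * _
                exact ENNReal.rpow_le_rpow_of_exponent_ge
                  (pow_le_one₀ bot_le (by simp)) hτ
            _ = _ := by rw [ENNReal.rpow_one]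
      _ = _ := by rw [ENNReal.tsum_mul_right, ENNReal.tsum_geometric_two]
  · intro c r x hx
    have hB : volume (ball c r) ≠ 0 := volume_ball_ne_zero c (pos_of_mem_ball hx)
    calc (∫⁻ y in ball c r, P y) / volume (ball c r)
        = ∑' k, (2⁻¹ : ℝ≥0∞) ^ k * ((2⁻¹ : ℝ≥0∞) ^ k * (L⁻¹ ^ k *
            ((∫⁻ y in ball c r, M k y) / volume (ball c r)))) := by
          simp only [hP]
          rw [lintegral_tsum fun k => ((((hMm k).const_mul _).const_mul _).const_mul _).aemeasurable,
            div_eq_mul_inv, ← ENNReal.tsum_mul_right]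
          congr 1
          ext k
          rw [lintegral_const_mul' _ _ (by simp), lintegral_const_mul' _ _ (by simp),
            lintegral_const_mul' _ _ (by simp [hL0]), div_eq_mul_inv]
          ring
      _ ≤ ∑' k, (2⁻¹ : ℝ≥0∞) ^ k * ((2⁻¹ : ℝ≥0∞) ^ k * (L⁻¹ ^ k * M (k + 1) x)) := by
          gcongr with k
          rw [hMs]
          exact le_maxFn _ _ hx
      _ = ∑' k, 4 * L * ((2⁻¹ : ℝ≥0∞) ^ (k + 1) * ((2⁻¹ : ℝ≥0∞) ^ (k + 1) *
            (L⁻¹ ^ (k + 1) * M (k + 1) x))) := by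
          congr 1
          ext k
          have e1 : L * L⁻¹ = 1 := ENNReal.mul_inv_cancel hL0 hLt
          have e2 : (2 : ℝ≥0∞) * 2⁻¹ = 1 := ENNReal.mul_inv_cancel (by simp) (by simp)
          calc _ = (2 * 2⁻¹) * (2 * 2⁻¹) * (L * L⁻¹) * ((2⁻¹ : ℝ≥0∞) ^ k * ((2⁻¹ : ℝ≥0∞) ^ k *
                (L⁻¹ ^ k * M (k + 1) x))) := by rw [e1, e2]; ring
            _ = _ := by ring
      _ = 4 * L * ∑' k, ((2⁻¹ : ℝ≥0∞) ^ (k + 1) * ((2⁻¹ : ℝ≥0∞) ^ (k + 1) *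
            (L⁻¹ ^ (k + 1) * M (k + 1) x))) := ENNReal.tsum_mul_left
      _ ≤ 4 * L * P x := by
          gcongr
          simp only [hP]
          conv_rhs => rw [tsum_eq_zero_add' ENNReal.summable]
          exact le_add_self

lemma recipNorm_mul_rpow {α : Type*} [MeasurableSpace α] {μ : Measure α} [IsProbabilityMeasure μ]
    {b t : ℝ} (ht : 0 ≤ t) (u : α → ℝ≥0∞) :
    recipNorm μ (b * t) (fun x => u x ^ t) = recipNorm μ b u ^ t := by
  rcases ht.eq_or_lt with rfl | ht
  · simp [recipNorm_one]
  · rw [recipNorm_rpow ht, mul_div_cancel_right₀ _ ht.ne']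

lemma recipNorm_one_mul_recipNorm_zero_inv_le {α : Type*} [MeasurableSpace α] {μ : Measure α}
    {P : α → ℝ≥0∞} {C : ℝ≥0∞}
    (h : ∀ᵐ x ∂μ, recipNorm μ 1 P ≤ C * P x) :
    recipNorm μ 1 P * recipNorm μ 0 (fun x => (P x)⁻¹) ≤ C := by
  rw [recipNorm_zero, ← ENNReal.essSup_const_mul]
  refine essSup_le_of_ae_le _ ?_
  filter_upwards [h] with x hx
  rw [← div_eq_mul_inv]
  exact ENNReal.div_le_of_le_mul hx

/-- If `v` lies in a two-exponent class, then every integrable function has an integrable majorant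
`G'` which can be used to shift the exponents of the class. -/
lemma InClass.exists_majorant {b a γ : ℝ} {v : (Fin d → ℝ) → ℝ≥0∞} (h : InClass b a v)
    (hb : 0 < b) (ha : 0 < a) (hγ : 0 < γ) (hγb : γ ≤ b) {G : (Fin d → ℝ) → ℝ≥0∞}
    (hG : Measurable G) (hGi : ∫⁻ x, G x ≠ ⊤) :
    ∃ G' : (Fin d → ℝ) → ℝ≥0∞, Measurable G' ∧ (∀ x, G' x ≠ 0) ∧ (∀ x, G' x ≠ ⊤) ∧
      (∀ᵐ x, G x ≤ G' x) ∧ ∫⁻ x, G' x ≠ ⊤ ∧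
      InClass (b - γ) (a + γ) (fun x => v x * G' x ^ (-γ)) := by
  have hv := h.meas
  have hpow0 : ∀ (x) (s : ℝ), v x ^ s ≠ 0 := fun x s => by simp [h.ne_zero x, h.ne_top x]
  have hpowt : ∀ (x) (s : ℝ), v x ^ s ≠ ⊤ := fun x s => by simp [h.ne_zero x, h.ne_top x]
  set A : (Fin d → ℝ) → ℝ≥0∞ := fun x => v x ^ (1 / b) with hA
  have hAm : Measurable A := by fun_prop
  set τ : ℝ := (a + b) / b with hτ
  have hτ0 : 0 < τ := by positivity
  obtain ⟨K, hK, hM⟩ := h.lintegral_maxFn_volume_le hb ha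
  obtain ⟨g, hg0, hgm, hgi⟩ := exists_pos_lintegral_lt_of_sigmaFinite
    (volume : Measure (Fin d → ℝ)) (ε := 1) one_ne_zero
  set P₀ : (Fin d → ℝ) → ℝ≥0∞ := fun x => ((G x + g x) * (A x)⁻¹) ^ (1 / τ) with hP₀
  have hP₀m : Measurable P₀ := by fun_prop
  have hP₀τ : ∀ x, P₀ x ^ τ * A x = G x + g x := fun x => by
    simp only [hP₀]
    rw [← ENNReal.rpow_mul, one_div_mul_cancel hτ0.ne', ENNReal.rpow_one, mul_assoc,
      ENNReal.inv_mul_cancel (hpow0 x _) (hpowt x _), mul_one]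
  obtain ⟨P, hPm, hP₀P, hPi, C₂, hC₂, hPC⟩ := exists_ge_average_le hAm (τ := τ)
    (by rw [hτ, le_div_iff₀ hb]; linarith) hK hM hP₀m (by
      simp only [hP₀τ]
      rw [lintegral_add_left hG]
      exact ENNReal.add_ne_top.2 ⟨hGi, (hgi.trans one_lt_top).ne⟩)
  have hPt : ∀ᵐ x, P x ≠ ⊤ := by
    filter_upwards [ae_lt_top (by fun_prop) hPi] with x hx htop
    rw [htop, ENNReal.top_rpow_of_pos hτ0, ENNReal.top_mul (hpow0 x _)] at hx
    exact lt_irrefl _ hx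
  have hP0 : ∀ x, P x ≠ 0 := fun x h0 => by
    have h1 : P₀ x = 0 := le_antisymm (h0 ▸ hP₀P x) bot_le
    have h2 := hP₀τ x
    rw [h1, ENNReal.zero_rpow_of_pos hτ0, zero_mul] at h2
    exact ((ENNReal.coe_pos.2 (hg0 x)).trans_le le_add_self).ne h2
  set Q : (Fin d → ℝ) → ℝ≥0∞ := fun x => if P x = ⊤ then 1 else P x with hQ
  have hQm : Measurable Q :=
    Measurable.ite (hPm (measurableSet_singleton ⊤)) measurable_const hPm
  have hQt : ∀ x, Q x ≠ ⊤ := fun x => by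
    simp only [hQ]; split_ifs with hx
    exacts [one_ne_top, hx]
  have hQ0 : ∀ x, Q x ≠ 0 := fun x => by
    simp only [hQ]; split_ifs with hx
    exacts [one_ne_zero, hP0 x]
  have hQP : Q =ᵐ[volume] P := by
    filter_upwards [hPt] with x hx
    simp [hQ, hx]
  have hQpow0 : ∀ (x) (s : ℝ), Q x ^ s ≠ 0 := fun x s => by simp [hQ0 x, hQt x]
  have hQpowt : ∀ (x) (s : ℝ), Q x ^ s ≠ ⊤ := fun x s => by simp [hQ0 x, hQt x]
  refine ⟨fun x => Q x ^ τ * A x, by fun_prop, fun x => mul_ne_zero (hQpow0 x _) (hpow0 x _),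
    fun x => ENNReal.mul_ne_top (hQpowt x _) (hpowt x _), ?_, ?_, ?_⟩
  · filter_upwards [hQP] with x hx
    rw [hx]
    calc G x ≤ G x + g x := le_self_add
      _ = P₀ x ^ τ * A x := (hP₀τ x).symm
      _ ≤ P x ^ τ * A x := by gcongr; exact hP₀P x
  · rwa [lintegral_congr_ae (g := fun x => P x ^ τ * A x) (hQP.mono fun x hx => by simp only [hx])]
  set s : ℝ := γ * τ with hs
  have hs0 : 0 < s := by positivity
  have ht0 : 0 ≤ (b - γ) / b := div_nonneg (by linarith) hb.le
  have hform : (fun x => v x * (Q x ^ τ * A x) ^ (-γ)) =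
      fun x => v x ^ ((b - γ) / b) * (Q x)⁻¹ ^ s := by
    ext x
    rw [ENNReal.mul_rpow_of_ne_top (hQpowt x _) (hpowt x _), ← ENNReal.rpow_mul,
      ENNReal.inv_rpow, ← ENNReal.rpow_neg, mul_left_comm, mul_comm]
    rw [← ENNReal.rpow_mul]
    congr 1
    · rw [show (b - γ) / b = 1 + 1 / b * -γ by field_simp; ring,
        ENNReal.rpow_add _ _ (h.ne_zero x) (h.ne_top x), ENNReal.rpow_one]
    · congr 1
      rw [hs]; ring
  rw [hform]
  obtain ⟨C, hC, hbd⟩ := h.bound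
  refine ⟨by fun_prop, fun x => ?_, fun x => ?_, C ^ ((b - γ) / b) * C₂ ^ s, ?_, ?_⟩
  · rw [ENNReal.inv_rpow]
    exact mul_ne_zero (hpow0 x _) (ENNReal.inv_ne_zero.2 (hQpowt x _))
  · rw [ENNReal.inv_rpow]
    exact ENNReal.mul_ne_top (hpowt x _) (ENNReal.inv_ne_top.2 (hQpow0 x _))
  · exact ENNReal.mul_ne_top (ENNReal.rpow_ne_top_of_nonneg ht0 hC)
      (ENNReal.rpow_ne_top_of_nonneg hs0.le hC₂)
  intro c r hr
  have := isProbabilityMeasure_ballAvg c hr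
  have hA1 : recipNorm (ballAvg c r) 1 Q * recipNorm (ballAvg c r) 0 (fun x => (Q x)⁻¹) ≤ C₂ := by
    refine recipNorm_one_mul_recipNorm_zero_inv_le ?_
    have h1 := ae_ballAvg_of_ae hQP c r
    have h2 : ∀ᵐ x ∂ballAvg c r, x ∈ ball c r :=
      (ballAvg_absolutelyContinuous c r).ae_le (ae_restrict_mem measurableSet_ball)
    filter_upwards [h1, h2] with x hx hxB
    rw [recipNorm_congr_ae h1, hx, recipNorm_one_eq, lintegral_ballAvg]
    exact hPC c r x hxB
  have hN1 : recipNorm (ballAvg c r) (b - γ) (fun x => v x ^ ((b - γ) / b) * (Q x)⁻¹ ^ s) ≤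
      recipNorm (ballAvg c r) b v ^ ((b - γ) / b) *
        recipNorm (ballAvg c r) 0 (fun x => (Q x)⁻¹) ^ s := by
    have := recipNorm_mul_le (μ := ballAvg c r) (b := b - γ) (c := 0) (by linarith) le_rfl
      (hv.pow_const ((b - γ) / b)).aemeasurable (hQm.inv.pow_const s).aemeasurable
    rw [add_zero] at this
    refine this.trans_eq ?_
    congr 1
    · rw [← recipNorm_mul_rpow ht0, mul_div_cancel₀ _ hb.ne']
    · rw [← recipNorm_mul_rpow hs0.le, zero_mul]; rfl
  have hN2 : recipNorm (ballAvg c r) (a + γ) (fun x => (v x ^ ((b - γ) / b) * (Q x)⁻¹ ^ s)⁻¹) ≤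
      recipNorm (ballAvg c r) a (fun x => (v x)⁻¹) ^ ((b - γ) / b) *
        recipNorm (ballAvg c r) 1 Q ^ s := by
    have := recipNorm_mul_le (μ := ballAvg c r) (b := a * ((b - γ) / b)) (c := s)
      (by positivity) hs0.le
      (hv.inv.pow_const ((b - γ) / b)).aemeasurable (hQm.pow_const s).aemeasurable
    rw [show a * ((b - γ) / b) + s = a + γ by rw [hs, hτ]; field_simp; ring] at this
    rw [← recipNorm_mul_rpow ht0, ← recipNorm_mul_rpow hs0.le, one_mul]
    refine le_trans (le_of_eq ?_) this
    congr 1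
    ext x
    rw [ENNReal.inv_rpow (Q x), ENNReal.mul_inv (Or.inl (hpow0 x _)) (Or.inl (hpowt x _)), inv_inv,
      ← ENNReal.inv_rpow]
    rfl
  calc _ ≤ (recipNorm (ballAvg c r) b v ^ ((b - γ) / b) *
        recipNorm (ballAvg c r) 0 (fun x => (Q x)⁻¹) ^ s) *
        (recipNorm (ballAvg c r) a (fun x => (v x)⁻¹) ^ ((b - γ) / b) *
        recipNorm (ballAvg c r) 1 Q ^ s) := mul_le_mul' hN1 hN2
    _ = (recipNorm (ballAvg c r) b v * recipNorm (ballAvg c r) a (fun x => (v x)⁻¹)) ^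
          ((b - γ) / b) *
        (recipNorm (ballAvg c r) 1 Q * recipNorm (ballAvg c r) 0 (fun x => (Q x)⁻¹)) ^ s := by
        rw [ENNReal.mul_rpow_of_nonneg _ _ ht0, ENNReal.mul_rpow_of_nonneg _ _ hs0.le]
        ring
    _ ≤ _ := by gcongr; exact hbd c r hr

end RubioDeFrancia

section LebesgueExtrapolation

/-! ### Limited-range extrapolation on weighted Lebesgue spaces -/

lemma exists_lt_two_pow {C : ℝ≥0∞} (hC : C ≠ ⊤) : ∃ n : ℕ, C < 2 ^ n := by
  obtain ⟨n, hn⟩ := ENNReal.exists_nat_gt hC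
  exact ⟨n, hn.trans (mod_cast Nat.lt_two_pow_self)⟩

variable {d : ℕ} {I : Type*}

/-- The family of pairs `(F i, H i)` satisfies a uniform inequality
`‖H i * v‖_{L^p} ≤ C ‖F i * v‖_{L^p}`. -/
def BddOn (F H : I → (Fin d → ℝ) → ℝ≥0∞) (p : ℝ) (v : (Fin d → ℝ) → ℝ≥0∞) : Prop :=
  ∃ C : ℝ≥0∞, C ≠ ⊤ ∧ ∀ i, ∫⁻ x, (H i x * v x) ^ p ≤ C * ∫⁻ x, (F i x * v x) ^ p

variable {F H : I → (Fin d → ℝ) → ℝ≥0∞} {p p₁ b a : ℝ} {v : (Fin d → ℝ) → ℝ≥0∞}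

lemma not_bddOn (h : ¬ BddOn F H p v) {C : ℝ≥0∞} (hC : C ≠ ⊤) :
    ∃ i, C * ∫⁻ x, (F i x * v x) ^ p < ∫⁻ x, (H i x * v x) ^ p := by
  by_contra! h'
  exact h ⟨C, hC, h'⟩

lemma lintegral_tsum_div_le {X : ℕ → (Fin d → ℝ) → ℝ≥0∞} (hX : ∀ n, Measurable (X n)) :
    ∫⁻ x, ∑' n, (2⁻¹ : ℝ≥0∞) ^ n * (X n x / ∫⁻ y, X n y) ≤ 2 := by
  rw [lintegral_tsum fun n => (((hX n).div_const _).const_mul _).aemeasurable]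
  calc _ ≤ ∑' n, (2⁻¹ : ℝ≥0∞) ^ n * 1 := by
        gcongr with n
        rw [lintegral_const_mul' _ _ (by simp)]
        gcongr
        simp_rw [div_eq_mul_inv]
        rw [lintegral_mul_const _ (hX n)]
        exact ENNReal.mul_inv_le_one _
    _ = _ := by simp_rw [mul_one]; exact ENNReal.tsum_geometric_two

lemma ae_le_tsum_div {X : ℕ → (Fin d → ℝ) → ℝ≥0∞} (hX : ∀ n, Measurable (X n)) (n : ℕ)
    (ht : ∫⁻ y, X n y ≠ ⊤) :
    ∀ᵐ x, X n x ≤ 2 ^ n * (∫⁻ y, X n y) * ∑' n, (2⁻¹ : ℝ≥0∞) ^ n * (X n x / ∫⁻ y, X n y) := by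
  by_cases h0 : ∫⁻ y, X n y = 0
  · filter_upwards [(lintegral_eq_zero_iff (hX n)).1 h0] with x hx
    rw [hx]; exact bot_le
  · refine ae_of_all _ fun x => ?_
    calc X n x = 2 ^ n * (∫⁻ y, X n y) * ((2⁻¹ : ℝ≥0∞) ^ n * (X n x / ∫⁻ y, X n y)) := by
          rw [mul_mul_mul_comm, ENNReal.mul_div_cancel h0 ht, ← ENNReal.inv_pow,
            ENNReal.mul_inv_cancel (by simp) (by simp), one_mul]
      _ ≤ _ := by
          gcongr
          exact ENNReal.le_tsum (f := fun n => (2⁻¹ : ℝ≥0∞) ^ n * (X n x / ∫⁻ y, X n y)) n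

/-- Extrapolation down from the exponent `p₁` to `p < p₁`. -/
lemma bddOn_of_lt (hF : ∀ i, Measurable (F i)) (hH : ∀ i, Measurable (H i)) (hp : 0 < p)
    (hpp : p < p₁) (hv : InClass b a v) (hb : 0 < b) (ha : 0 < a) (hγ : 1 / p - 1 / p₁ ≤ b)
    (hyp : ∀ v₁, InClass (b - (1 / p - 1 / p₁)) (a + (1 / p - 1 / p₁)) v₁ → BddOn F H p₁ v₁) :
    BddOn F H p v := by
  by_contra hcon
  have hp₁ : 0 < p₁ := hp.trans hpp
  set γ := 1 / p - 1 / p₁ with hγdef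
  have hγ0 : 0 < γ := sub_pos.2 (one_div_lt_one_div_of_lt hp hpp)
  choose i hi using fun n : ℕ => not_bddOn hcon (C := 4 ^ n) (by simp)
  have hvm := hv.meas
  set X : ℕ → (Fin d → ℝ) → ℝ≥0∞ := fun n x => (F (i n) x * v x) ^ p with hX
  have hXm : ∀ n, Measurable (X n) := fun n => ((hF (i n)).mul hvm).pow_const _
  have hXt : ∀ n, ∫⁻ y, X n y ≠ ⊤ := fun n h => by
    have := hi n
    simp only [hX] at h
    rw [h, ENNReal.mul_top (by simp)] at this
    exact not_top_lt this
  have hGm : Measurable fun x => ∑' n, (2⁻¹ : ℝ≥0∞) ^ n * (X n x / ∫⁻ y, X n y) :=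
    Measurable.tsum fun n => ((hXm n).div_const _).const_mul _
  obtain ⟨G, hG'm, hG0, hGt, hGG, hGi, hcls⟩ := hv.exists_majorant hb ha hγ0 hγ hGm
    (ne_top_of_le_ne_top (by simp) (lintegral_tsum_div_le hXm))
  obtain ⟨C, hC, hbd⟩ := hyp _ hcls
  set J := ∫⁻ x, G x with hJ
  have hle : ∀ n, 4 ^ n * ∫⁻ y, X n y < C ^ (p / p₁) * J * 2 ^ n * ∫⁻ y, X n y := by
    intro n
    have hf : ∫⁻ x, (F (i n) x * (v x * G x ^ (-γ))) ^ p₁ ≤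
        (2 ^ n * ∫⁻ y, X n y) ^ (p₁ / p) * J := by
      rw [hJ, ← lintegral_const_mul _ hG'm]
      refine lintegral_mono_ae ?_
      filter_upwards [hGG, ae_le_tsum_div hXm n (hXt n)] with x hx1 hx2
      calc (F (i n) x * (v x * G x ^ (-γ))) ^ p₁
          = X n x ^ (p₁ / p) * G x ^ (-γ * p₁) := by
            simp only [hX]
            rw [← mul_assoc, ENNReal.mul_rpow_of_nonneg _ _ hp₁.le, ← ENNReal.rpow_mul,
              ← ENNReal.rpow_mul, mul_div_cancel₀ _ hp.ne']
        _ ≤ (2 ^ n * (∫⁻ y, X n y) * G x) ^ (p₁ / p) * G x ^ (-γ * p₁) := by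
            gcongr
            exact hx2.trans (by gcongr)
        _ = _ := by
            rw [ENNReal.mul_rpow_of_nonneg _ _ (by positivity), mul_assoc,
              ← ENNReal.rpow_add _ _ (hG0 x) (hGt x)]
            conv_rhs => rw [← ENNReal.rpow_one (G x)]
            congr 2
            rw [hγdef]; field_simp; ring
    have hh : ∫⁻ x, (H (i n) x * v x) ^ p ≤
        (∫⁻ x, (H (i n) x * (v x * G x ^ (-γ))) ^ p₁) ^ (p / p₁) * J ^ (γ * p) := by
      have := ENNReal.lintegral_mul_norm_pow_le (μ := (volume : Measure (Fin d → ℝ)))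
        (f := fun x => (H (i n) x * (v x * G x ^ (-γ))) ^ p₁) (g := G)
        (((hH (i n)).mul (hvm.mul (hG'm.pow_const _))).pow_const _).aemeasurable hG'm.aemeasurable
        (p := p / p₁) (q := γ * p) (by positivity) (by positivity) (by
          rw [hγdef]; field_simp; ring)
      refine le_trans (le_of_eq (lintegral_congr fun x => ?_)) this
      rw [← ENNReal.rpow_mul, mul_div_cancel₀ _ hp₁.ne', ENNReal.rpow_mul,
        ← ENNReal.mul_rpow_of_nonneg _ _ hp.le, mul_assoc, mul_assoc,
        ← ENNReal.rpow_add _ _ (hG0 x) (hGt x), neg_add_cancel, ENNReal.rpow_zero, mul_one]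
    calc 4 ^ n * ∫⁻ y, X n y < ∫⁻ x, (H (i n) x * v x) ^ p := hi n
      _ ≤ (C * ((2 ^ n * ∫⁻ y, X n y) ^ (p₁ / p) * J)) ^ (p / p₁) * J ^ (γ * p) := by
          refine hh.trans ?_
          gcongr
          exact (hbd (i n)).trans (by gcongr)
      _ = C ^ (p / p₁) * (2 ^ n * ∫⁻ y, X n y) * (J ^ (p / p₁) * J ^ (γ * p)) := by
          rw [ENNReal.mul_rpow_of_nonneg _ _ (by positivity),
            ENNReal.mul_rpow_of_nonneg _ _ (by positivity), ← ENNReal.rpow_mul,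
            div_mul_div_cancel₀ hp.ne', div_self hp₁.ne', ENNReal.rpow_one]
          ring
      _ = _ := by
          rw [← ENNReal.rpow_add_of_nonneg _ _ (by positivity) (by positivity),
            show p / p₁ + γ * p = 1 by rw [hγdef]; field_simp; ring, ENNReal.rpow_one]
          ring
  obtain ⟨n, hn⟩ := exists_lt_two_pow (C := C ^ (p / p₁) * J)
    (ENNReal.mul_ne_top (ENNReal.rpow_ne_top_of_nonneg (by positivity) hC) hGi)
  refine (hle n).not_ge ?_
  calc _ ≤ 2 ^ n * 2 ^ n * ∫⁻ y, X n y := by gcongr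
    _ = _ := by rw [← mul_pow]; norm_num

/-- Extrapolation up from the exponent `p₁` to `p > p₁`. -/
lemma bddOn_of_gt (hF : ∀ i, Measurable (F i)) (hHt : ∀ i x, H i x ≠ ⊤)
    (hp₁ : 0 < p₁) (hpp : p₁ < p) (hv : InClass b a v) (hb : 0 < b) (ha : 0 < a) (hγ : 1 / p₁ - 1 / p ≤ a)
    (hyp : ∀ v₁, InClass (b + (1 / p₁ - 1 / p)) (a - (1 / p₁ - 1 / p)) v₁ → BddOn F H p₁ v₁) :
    BddOn F H p v := by
  by_contra hcon
  have hp : 0 < p := hp₁.trans hpp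
  set γ := 1 / p₁ - 1 / p with hγdef
  have hγ0 : 0 < γ := sub_pos.2 (one_div_lt_one_div_of_lt hp₁ hpp)
  have hγp : p₁ / p + γ * p₁ = 1 := by rw [hγdef]; field_simp; ring
  choose i hi using fun n : ℕ => not_bddOn hcon (C := (4 ^ n) ^ (p / p₁))
    (ENNReal.rpow_ne_top_of_nonneg (by positivity) (by simp))
  have hvm := hv.meas
  obtain ⟨X, hXm, hXle, hXlt, hXt⟩ : ∃ X : ℕ → (Fin d → ℝ) → ℝ≥0∞, (∀ n, Measurable (X n)) ∧
      (∀ n x, X n x ≤ (H (i n) x * v x) ^ p) ∧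
      (∀ n, (4 ^ n) ^ (p / p₁) * ∫⁻ x, (F (i n) x * v x) ^ p < ∫⁻ x, X n x) ∧
      ∀ n, ∫⁻ x, X n x ≠ ⊤ := by
    have hfin : ∀ n x, (((H (i n) x * v x) ^ p).toNNReal : ℝ≥0∞) = (H (i n) x * v x) ^ p :=
      fun n x => ENNReal.coe_toNNReal (ENNReal.rpow_ne_top_of_nonneg hp.le
        (ENNReal.mul_ne_top (hHt _ x) (hv.ne_top x)))
    choose φ hφ hφt hφlt using fun n : ℕ => exists_lt_lintegral_simpleFunc_of_lt_lintegral
      (f := fun x => ((H (i n) x * v x) ^ p).toNNReal) (by simpa only [hfin] using hi n)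
    refine ⟨fun n x => φ n x, fun n => (φ n).measurable.coe_nnreal_ennreal, fun n x => ?_, hφlt,
      fun n => (hφt n).ne⟩
    rw [← hfin]
    exact ENNReal.coe_le_coe.2 (hφ n x)
  have hGm : Measurable fun x => ∑' n, (2⁻¹ : ℝ≥0∞) ^ n * (X n x / ∫⁻ y, X n y) :=
    Measurable.tsum fun n => ((hXm n).div_const _).const_mul _
  obtain ⟨G, hG'm, hG0, hGt, hGG, hGi, hcls⟩ := hv.symm.exists_majorant ha hb hγ0 hγ hGm
    (ne_top_of_le_ne_top (by simp) (lintegral_tsum_div_le hXm))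
  have hcls' := hcls.symm
  have hw : (fun x => ((v x)⁻¹ * G x ^ (-γ))⁻¹) = fun x => v x * G x ^ γ := by
    ext x
    rw [ENNReal.mul_inv (Or.inr (by simp [hG0 x, hGt x])) (Or.inr (by simp [hG0 x, hGt x])),
      inv_inv, ENNReal.rpow_neg, inv_inv]
  rw [hw] at hcls'
  obtain ⟨C, hC, hbd⟩ := hyp _ hcls'
  set J := ∫⁻ x, G x with hJ
  have hle : ∀ n, 2 ^ n ≤ C * J ^ (γ * p₁) := by
    intro n
    set S := ∫⁻ x, (F (i n) x * v x) ^ p with hS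
    set Y := ∫⁻ x, X n x with hY
    have hSY : (4 ^ n) ^ (p / p₁) * S < Y := hXlt n
    have hYt : Y ≠ ⊤ := hXt n
    have hY0 : Y ≠ 0 := (bot_le.trans_lt hSY).ne'
    have hSt : S ≠ ⊤ := fun h => by
      rw [h, ENNReal.mul_top] at hSY
      · exact not_top_lt hSY
      · simp [hp]
    have hf : ∫⁻ x, (F (i n) x * (v x * G x ^ γ)) ^ p₁ ≤ S ^ (p₁ / p) * J ^ (γ * p₁) := by
      have := ENNReal.lintegral_mul_norm_pow_le (μ := (volume : Measure (Fin d → ℝ)))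
        (f := fun x => (F (i n) x * v x) ^ p) (g := G)
        (((hF (i n)).mul hvm).pow_const _).aemeasurable hG'm.aemeasurable
        (p := p₁ / p) (q := γ * p₁) (by positivity) (by positivity) hγp
      refine le_trans (le_of_eq (lintegral_congr fun x => ?_)) this
      rw [← ENNReal.rpow_mul, mul_div_cancel₀ _ hp.ne', ENNReal.rpow_mul (G x),
        ← ENNReal.mul_rpow_of_nonneg _ _ hp₁.le, mul_assoc]
    have hh : Y ≤ (2 ^ n * Y) ^ (γ * p₁) * ∫⁻ x, (H (i n) x * (v x * G x ^ γ)) ^ p₁ := by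
      rw [hY, ← hY, ← lintegral_const_mul' _ _ (ENNReal.rpow_ne_top_of_nonneg (by positivity)
        (ENNReal.mul_ne_top (by simp) hYt))]
      refine lintegral_mono_ae ?_
      filter_upwards [hGG, ae_le_tsum_div hXm n (hXt n)] with x hx1 hx2
      have h1 : X n x ≤ 2 ^ n * Y * G x := hx2.trans (by gcongr)
      calc X n x = X n x ^ (p₁ / p) * X n x ^ (γ * p₁) := by
            rw [← ENNReal.rpow_add_of_nonneg _ _ (by positivity) (by positivity), hγp,
              ENNReal.rpow_one]
        _ ≤ ((H (i n) x * v x) ^ p) ^ (p₁ / p) * (2 ^ n * Y * G x) ^ (γ * p₁) := by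
            gcongr
            exact hXle n x
        _ = _ := by
            rw [← ENNReal.rpow_mul, mul_div_cancel₀ _ hp.ne',
              ENNReal.mul_rpow_of_nonneg _ _ (z := γ * p₁) (by positivity), ENNReal.rpow_mul (G x),
              mul_left_comm, ← ENNReal.mul_rpow_of_nonneg _ _ hp₁.le, mul_assoc]
    have hlow : 4 ^ n * S ^ (p₁ / p) ≤ Y ^ (p₁ / p) := by
      calc 4 ^ n * S ^ (p₁ / p) = ((4 ^ n) ^ (p / p₁) * S) ^ (p₁ / p) := by
            rw [ENNReal.mul_rpow_of_nonneg _ _ (by positivity), ← ENNReal.rpow_mul,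
              div_mul_div_cancel₀ hp₁.ne', div_self hp.ne', ENNReal.rpow_one]
        _ ≤ _ := by gcongr
    have hmain : Y ^ (p₁ / p) ≤ 2 ^ n * (C * J ^ (γ * p₁)) * S ^ (p₁ / p) := by
      have hYp : Y ^ (γ * p₁) ≠ 0 := by
        simp [hY0, hYt]
      have hYpt : Y ^ (γ * p₁) ≠ ⊤ := ENNReal.rpow_ne_top_of_nonneg (by positivity) hYt
      have h2 : ((2 : ℝ≥0∞) ^ n) ^ (γ * p₁) ≤ 2 ^ n := by
        conv_rhs => rw [← ENNReal.rpow_one (2 ^ n)]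
        refine ENNReal.rpow_le_rpow_of_exponent_le (one_le_pow₀ (by simp)) ?_
        have : 0 < p₁ / p := by positivity
        linarith
      refine (ENNReal.mul_le_mul_iff_left hYp hYpt).1 ?_
      calc Y ^ (p₁ / p) * Y ^ (γ * p₁) = Y := by
            rw [← ENNReal.rpow_add_of_nonneg _ _ (by positivity) (by positivity), hγp,
              ENNReal.rpow_one]
        _ ≤ (2 ^ n * Y) ^ (γ * p₁) * (C * (S ^ (p₁ / p) * J ^ (γ * p₁))) := by
            refine hh.trans ?_
            gcongr
            exact (hbd (i n)).trans (by gcongr)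
        _ ≤ 2 ^ n * Y ^ (γ * p₁) * (C * (S ^ (p₁ / p) * J ^ (γ * p₁))) := by
            rw [ENNReal.mul_rpow_of_nonneg _ _ (by positivity)]
            gcongr
        _ = _ := by ring
    have hS0 : S ^ (p₁ / p) ≠ 0 := by
      intro h0
      rw [h0, mul_zero] at hmain
      have := le_antisymm hmain bot_le
      rw [ENNReal.rpow_eq_zero_iff_of_pos (by positivity)] at this
      exact hY0 this
    have hSpt : S ^ (p₁ / p) ≠ ⊤ := ENNReal.rpow_ne_top_of_nonneg (by positivity) hSt
    have h3 := (ENNReal.mul_le_mul_iff_left hS0 hSpt).1 (hlow.trans hmain)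
    rw [show (4 : ℝ≥0∞) ^ n = 2 ^ n * 2 ^ n by rw [← mul_pow]; norm_num] at h3
    exact (ENNReal.mul_le_mul_iff_right (by simp) (by simp)).1 h3
  obtain ⟨n, hn⟩ := exists_lt_two_pow (C := C * J ^ (γ * p₁))
    (ENNReal.mul_ne_top hC (ENNReal.rpow_ne_top_of_nonneg (by positivity) hGi))
  exact (hle n).not_gt hn

/-- **Limited-range extrapolation**: uniform weighted inequalities at one exponent `p₁` self-improve
to all exponents strictly between `q` and `r`. -/
lemma bddOn_of_bddOn {q r : ℝ} (hF : ∀ i, Measurable (F i)) (hH : ∀ i, Measurable (H i))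
    (hHt : ∀ i x, H i x ≠ ⊤) (hq : 0 < q) (hqp₁ : q ≤ p₁) (hp₁r : p₁ ≤ r)
    (hyp : ∀ v, InClass (1 / p₁ - 1 / r) (1 / q - 1 / p₁) v → BddOn F H p₁ v)
    (hqp : q < p) (hpr : p < r) (hv : InClass (1 / p - 1 / r) (1 / q - 1 / p) v) :
    BddOn F H p v := by
  have hp : 0 < p := hq.trans hqp
  have hp₁ : 0 < p₁ := hq.trans_le hqp₁
  have hb : 0 < 1 / p - 1 / r := sub_pos.2 (one_div_lt_one_div_of_lt hp hpr)
  have ha : 0 < 1 / q - 1 / p := sub_pos.2 (one_div_lt_one_div_of_lt hq hqp)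
  have h1 := one_div_le_one_div_of_le hq hqp₁
  have h2 := one_div_le_one_div_of_le hp₁ hp₁r
  rcases lt_trichotomy p p₁ with h | rfl | h
  · refine bddOn_of_lt hF hH hp h hv hb ha (by linarith) fun v₁ hv₁ => hyp v₁ ?_
    convert hv₁ using 1 <;> ring
  · exact hyp v hv
  · refine bddOn_of_gt hF hHt hp₁ h hv hb ha (by linarith) fun v₁ hv₁ => hyp v₁ ?_
    convert hv₁ using 1 <;> ring

end LebesgueExtrapolation

section Decay

/-! ### Truncated power weights -/

lemma rpow_tsum_le {e : ℝ} (he : 0 < e) (he1 : e ≤ 1) (y : ℕ → ℝ≥0∞) :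
    (∑' k, y k) ^ e ≤ ∑' k, y k ^ e := by
  have := (ENNReal.orderIsoRpow e he).map_iSup fun s : Finset ℕ => ∑ k ∈ s, y k
  simp only [ENNReal.orderIsoRpow_apply] at this
  rw [ENNReal.tsum_eq_iSup_sum, this]
  refine iSup_le fun s => le_trans ?_ (ENNReal.sum_le_tsum s)
  classical
  induction s using Finset.induction_on with
  | empty => simp [he]
  | insert k s hk ih =>
    rw [Finset.sum_insert hk, Finset.sum_insert hk]
    exact (ENNReal.rpow_add_le_add_rpow _ _ he.le he1).trans (by gcongr)

variable {d : ℕ}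

/-- The function `x ↦ min 1 (r / |x - c|)`. -/
def decay (c : Fin d → ℝ) (r : ℝ) (x : Fin d → ℝ) : ℝ≥0∞ :=
  ENNReal.ofReal (r / max r (dist x c))

lemma measurable_decay (c : Fin d → ℝ) (r : ℝ) : Measurable (decay c r) := by
  unfold decay; fun_prop

section decay

variable {c x : Fin d → ℝ} {r : ℝ}

lemma decay_ne_top : decay c r x ≠ ⊤ := ENNReal.ofReal_ne_top

lemma decay_ne_zero (hr : 0 < r) : decay c r x ≠ 0 := by
  have : 0 < max r (dist x c) := lt_max_of_lt_left hr
  rw [decay, Ne, ENNReal.ofReal_eq_zero, not_le]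
  positivity

lemma decay_eq_one (hr : 0 < r) (hx : x ∈ ball c r) : decay c r x = 1 := by
  rw [decay, max_eq_left (mem_ball.1 hx).le, div_self hr.ne', ENNReal.ofReal_one]

lemma decay_le_of_le (hr : 0 < r) {t : ℝ} (ht : 0 < t) (h : t ≤ max r (dist x c)) :
    decay c r x ≤ ENNReal.ofReal (r / t) := by
  rw [decay]; gcongr

lemma lintegral_mul_decay_rpow_le {g : (Fin d → ℝ) → ℝ≥0∞} (hg : Measurable g) {κ : ℝ}
    (hκ : 0 ≤ κ) (hr : 0 < r) :
    ∫⁻ x, g x * decay c r x ^ κ ≤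
      2 ^ κ * ∑' k : ℕ, ((2⁻¹ : ℝ≥0∞) ^ κ) ^ k * ∫⁻ x in ball c (2 ^ k * r), g x := by
  have hpt : ∀ x, g x * decay c r x ^ κ ≤
      2 ^ κ * ∑' k : ℕ, ((2⁻¹ : ℝ≥0∞) ^ κ) ^ k * (ball c (2 ^ k * r)).indicator g x := by
    intro x
    have hex : ∃ k : ℕ, dist x c < 2 ^ k * r := by
      obtain ⟨k, hk⟩ := pow_unbounded_of_one_lt (dist x c / r) (one_lt_two (α := ℝ))
      exact ⟨k, (div_lt_iff₀ hr).1 hk⟩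
    classical
    set k := Nat.find hex with hk
    have hmem : x ∈ ball c (2 ^ k * r) := mem_ball.2 (Nat.find_spec hex)
    have hdec : decay c r x ≤ 2 * 2⁻¹ ^ k := by
      rcases hk' : k with _ | j
      · refine (decay_le_of_le hr hr (le_max_left _ _)).trans ?_
        simp [div_self hr.ne']
      · have hj : ¬ dist x c < 2 ^ j * r := Nat.find_min hex (by omega)
        refine (decay_le_of_le hr (t := 2 ^ j * r) (by positivity)
          ((not_lt.1 hj).trans (le_max_right _ _))).trans ?_
        rw [div_mul_cancel_right₀ hr.ne', pow_succ', ← mul_assoc,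
          ENNReal.mul_inv_cancel (by simp) (by simp), one_mul, ← inv_pow,
          ENNReal.ofReal_pow (by positivity), ENNReal.ofReal_inv_of_pos (by norm_num)]
        simp
    calc g x * decay c r x ^ κ ≤ g x * (2 * 2⁻¹ ^ k) ^ κ := by gcongr
      _ = 2 ^ κ * (((2⁻¹ : ℝ≥0∞) ^ κ) ^ k * (ball c (2 ^ k * r)).indicator g x) := by
          rw [Set.indicator_of_mem hmem, ENNReal.mul_rpow_of_nonneg _ _ hκ,
            ← ENNReal.rpow_natCast, ← ENNReal.rpow_natCast, ← ENNReal.rpow_mul,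
            ← ENNReal.rpow_mul, mul_comm κ]
          ring
      _ ≤ _ := by
          gcongr
          exact ENNReal.le_tsum (f := fun k : ℕ => ((2⁻¹ : ℝ≥0∞) ^ κ) ^ k *
            (ball c (2 ^ k * r)).indicator g x) k
  have h2 : (2 : ℝ≥0∞) ^ κ ≠ ⊤ := ENNReal.rpow_ne_top_of_nonneg hκ (by simp)
  have h2' : ((2⁻¹ : ℝ≥0∞)) ^ κ ≠ ⊤ := ENNReal.rpow_ne_top_of_nonneg hκ (by simp)
  refine (lintegral_mono hpt).trans_eq ?_
  rw [lintegral_const_mul' _ _ h2, lintegral_tsum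
    fun k => ((hg.indicator measurableSet_ball).const_mul _).aemeasurable]
  congr 2
  ext k
  rw [lintegral_const_mul' _ _ (ENNReal.pow_ne_top h2'), lintegral_indicator measurableSet_ball]

lemma two_rpow_mul_lt_one {κ : ℝ} (hκ : κ < d) : (2 : ℝ≥0∞) ^ κ * 2⁻¹ ^ d < 1 := by
  rw [← ENNReal.inv_pow, ← ENNReal.rpow_natCast, ← ENNReal.rpow_neg,
    ← ENNReal.rpow_add _ _ (by simp) (by simp)]
  exact ENNReal.rpow_lt_one_of_one_lt_of_neg (by simp) (by linarith)

lemma lintegral_ball_decay_rpow_le {κ R : ℝ} (hκ : 0 ≤ κ) (hr : 0 < r) (hR : 0 < R) :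
    ∫⁻ x in ball c R, decay c r x ^ κ ≤
      (1 - (2 : ℝ≥0∞) ^ κ * 2⁻¹ ^ d)⁻¹ * ENNReal.ofReal (r / (2⁻¹ * R)) ^ κ *
        volume (ball c R) := by
  set q : ℝ≥0∞ := ENNReal.ofReal (r / (2⁻¹ * R)) with hq
  have hpt : ∀ x ∈ ball c R, decay c r x ^ κ ≤
      ∑' k : ℕ, (ball c (2⁻¹ ^ k * R)).indicator (fun _ => (2 ^ k * q) ^ κ) x := by
    intro x hx
    have hex : ∃ k : ℕ, 2⁻¹ ^ (k + 1) * R ≤ max r (dist x c) := by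
      obtain ⟨k, hk⟩ := exists_pow_lt_of_lt_one (y := (2⁻¹ : ℝ)) (div_pos hr hR) (by norm_num)
      refine ⟨k, le_trans ?_ ((lt_div_iff₀ hR).1 hk).le |>.trans (le_max_left _ _)⟩
      gcongr ?_ * _
      exact pow_le_pow_of_le_one (by norm_num) (by norm_num) (Nat.le_succ k)
    classical
    set k := Nat.find hex with hk
    have hmem : x ∈ ball c (2⁻¹ ^ k * R) := by
      rcases hk' : k with _ | j
      · simpa using hx
      · have hj := not_le.1 (Nat.find_min hex (m := j) (by omega))
        exact mem_ball.2 ((le_max_right _ _).trans_lt hj)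
    have hdec : decay c r x ≤ 2 ^ k * q := by
      refine (decay_le_of_le hr (by positivity) (Nat.find_spec hex)).trans_eq ?_
      rw [← hk, hq, show (2 : ℝ≥0∞) ^ k = ENNReal.ofReal (2 ^ k) by
        rw [ENNReal.ofReal_pow (by norm_num)]; simp, ← ENNReal.ofReal_mul (by positivity)]
      congr 1
      rw [pow_succ, inv_pow]
      field_simp
    refine le_trans ?_ (ENNReal.le_tsum k)
    rw [Set.indicator_of_mem hmem]
    gcongr
  have hqt : ∀ k : ℕ, ((2 : ℝ≥0∞) ^ k * q) ^ κ = ((2 : ℝ≥0∞) ^ κ) ^ k * q ^ κ := fun k => by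
    rw [ENNReal.mul_rpow_of_nonneg _ _ hκ, ← ENNReal.rpow_natCast, ← ENNReal.rpow_natCast,
      ← ENNReal.rpow_mul, ← ENNReal.rpow_mul, mul_comm κ]
  calc _ ≤ ∫⁻ x, ∑' k : ℕ, (ball c (2⁻¹ ^ k * R)).indicator (fun _ => (2 ^ k * q) ^ κ) x :=
        (setLIntegral_mono' measurableSet_ball hpt).trans (setLIntegral_le_lintegral _ _)
    _ = ∑' k : ℕ, (2 ^ k * q) ^ κ * volume (ball c (2⁻¹ ^ k * R)) := by
        rw [lintegral_tsum fun k => (measurable_const.indicator measurableSet_ball).aemeasurable]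
        simp_rw [lintegral_indicator_const measurableSet_ball]
    _ = ∑' k : ℕ, ((2 : ℝ≥0∞) ^ κ * 2⁻¹ ^ d) ^ k * (q ^ κ * volume (ball c R)) := by
        congr 1
        ext k
        rw [volume_ball_mul c c (by positivity) hR, hqt, ENNReal.ofReal_pow (by norm_num),
          ENNReal.ofReal_inv_of_pos (by norm_num), mul_pow, ← pow_mul, ← pow_mul, mul_comm d,
          ENNReal.ofReal_ofNat]
        ring
    _ = _ := by
        rw [ENNReal.tsum_mul_right, ENNReal.tsum_geometric, mul_assoc]

/-- Truncated power weights of order less than the dimension are `A₁` weights, uniformly in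
the centre and the truncation radius. -/
lemma lintegral_ball_decay_rpow_le_mul {κ : ℝ} (hκ : 0 ≤ κ) (hr : 0 < r) {y : Fin d → ℝ} {l : ℝ}
    (hx : x ∈ ball y l) :
    ∫⁻ z in ball y l, decay c r z ^ κ ≤
      (1 + (1 - (2 : ℝ≥0∞) ^ κ * 2⁻¹ ^ d)⁻¹ * 6 ^ d) * 2 ^ κ * decay c r x ^ κ *
        volume (ball y l) := by
  have hl : 0 < l := pos_of_mem_ball hx
  have hm : 0 < max r (dist x c) := lt_max_of_lt_left hr
  rcases le_or_gt (4 * l) (max r (dist x c)) with h | h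
  · calc ∫⁻ z in ball y l, decay c r z ^ κ ≤ ∫⁻ z in ball y l, (2 * decay c r x) ^ κ := by
          refine setLIntegral_mono' measurableSet_ball fun z hz => ?_
          gcongr
          refine (decay_le_of_le hr (t := max r (dist x c) / 2) (by positivity) ?_).trans_eq ?_
          · have h1 : dist z x < 2 * l := by
              calc dist z x ≤ dist z y + dist x y := dist_triangle_right _ _ _
                _ < 2 * l := by linarith [mem_ball.1 hx, mem_ball.1 hz]
            have h2 := dist_triangle_left x c z
            rcases le_total r (dist x c) with h3 | h3
            · rw [max_eq_right h3] at h ⊢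
              exact le_max_of_le_right (by linarith)
            · rw [max_eq_left h3]
              exact le_max_of_le_left (by linarith)
          · rw [decay, show r / (max r (dist x c) / 2) = 2 * (r / max r (dist x c)) by field_simp,
              ENNReal.ofReal_mul (by norm_num), ENNReal.ofReal_ofNat]
      _ = 1 * 2 ^ κ * decay c r x ^ κ * volume (ball y l) := by
          rw [setLIntegral_const, ENNReal.mul_rpow_of_nonneg _ _ hκ, one_mul]
      _ ≤ _ := by gcongr; exact le_self_add
  · have hrl : r < 4 * l := (le_max_left _ _).trans_lt h
    have hxl : dist x c < 4 * l := (le_max_right _ _).trans_lt h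
    have hsub : ball y l ⊆ ball c (6 * l) := fun z hz => by
      rw [mem_ball] at *
      have := dist_triangle z y c
      have := dist_triangle_left y c x
      linarith
    calc ∫⁻ z in ball y l, decay c r z ^ κ ≤ ∫⁻ z in ball c (6 * l), decay c r z ^ κ :=
          lintegral_mono_set hsub
      _ ≤ _ := lintegral_ball_decay_rpow_le hκ hr (by positivity)
      _ ≤ (1 - (2 : ℝ≥0∞) ^ κ * 2⁻¹ ^ d)⁻¹ * (2 * decay c r x) ^ κ *
            (6 ^ d * volume (ball y l)) := by
          rw [volume_ball_mul c y (by norm_num) hl, ENNReal.ofReal_ofNat]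
          gcongr
          rw [decay, ← ENNReal.ofReal_ofNat 2, ← ENNReal.ofReal_mul (by norm_num)]
          apply ENNReal.ofReal_le_ofReal
          rw [← mul_div_assoc, div_le_div_iff₀ (by positivity) hm]
          nlinarith
      _ = ((1 - (2 : ℝ≥0∞) ^ κ * 2⁻¹ ^ d)⁻¹ * 6 ^ d) * 2 ^ κ * decay c r x ^ κ *
            volume (ball y l) := by
          rw [ENNReal.mul_rpow_of_nonneg _ _ hκ]; ring
      _ ≤ _ := by gcongr; exact le_add_self

end decay

end Decay

section MorreyEstimates

/-! ### From weighted Lebesgue spaces to weighted Morrey spaces -/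

variable {d : ℕ}

lemma InClass.mono {s b a : ℝ} {v : (Fin d → ℝ) → ℝ≥0∞} (h : InClass s a v) (hs : 0 ≤ s)
    (hsb : s ≤ b) : InClass b a v where
  meas := h.meas
  ne_zero := h.ne_zero
  ne_top := h.ne_top
  bound := by
    obtain ⟨C, hC, hbd⟩ := h.bound
    refine ⟨C, hC, fun c r hr => le_trans ?_ (hbd c r hr)⟩
    have := isProbabilityMeasure_ballAvg c hr
    gcongr
    exact recipNorm_le_recipNorm hs hsb h.meas.aemeasurable

/-- Multiplication by a power of an `A₁` weight shifts the first exponent of a class. -/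
lemma InClass.mul_rpow {s a t : ℝ} {v U : (Fin d → ℝ) → ℝ≥0∞} (h : InClass s a v) (hs : 0 ≤ s)
    (ha : 0 ≤ a) (ht : 0 ≤ t) (hU : Measurable U) (hU0 : ∀ x, U x ≠ 0) (hUt : ∀ x, U x ≠ ⊤)
    {C : ℝ≥0∞} (hC : C ≠ ⊤)
    (hA : ∀ c r, 0 < r → recipNorm (ballAvg c r) 1 U *
      recipNorm (ballAvg c r) 0 (fun x => (U x)⁻¹) ≤ C) :
    InClass (s + t) a fun x => v x * U x ^ t := by
  have hv := h.meas
  have hp0 : ∀ x, U x ^ t ≠ 0 := fun x => by simp [hU0 x, hUt x]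
  have hpt : ∀ x, U x ^ t ≠ ⊤ := fun x => by simp [hU0 x, hUt x]
  obtain ⟨C', hC', hbd⟩ := h.bound
  refine ⟨by fun_prop, fun x => mul_ne_zero (h.ne_zero x) (hp0 x),
    fun x => ENNReal.mul_ne_top (h.ne_top x) (hpt x), C' * C ^ t,
    ENNReal.mul_ne_top hC' (ENNReal.rpow_ne_top_of_nonneg ht hC), fun c r hr => ?_⟩
  have := isProbabilityMeasure_ballAvg c hr
  have h1 := recipNorm_mul_le (μ := ballAvg c r) hs ht hv.aemeasurable
    (hU.pow_const t).aemeasurable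
  have h2 := recipNorm_mul_le (μ := ballAvg c r) ha le_rfl hv.inv.aemeasurable
    (hU.inv.pow_const t).aemeasurable
  have e1 := recipNorm_mul_rpow (μ := ballAvg c r) (b := 1) ht U
  have e2 := recipNorm_mul_rpow (μ := ballAvg c r) (b := 0) ht fun x => (U x)⁻¹
  rw [one_mul] at e1
  rw [zero_mul] at e2
  have e3 : (fun x => (v x * U x ^ t)⁻¹) = fun x => v⁻¹ x * U⁻¹ x ^ t := by
    ext x
    rw [ENNReal.mul_inv (Or.inl (h.ne_zero x)) (Or.inl (h.ne_top x)), ← ENNReal.inv_rpow]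
    rfl
  rw [e1] at h1
  rw [add_zero] at h2
  rw [e3]
  calc _ ≤ recipNorm (ballAvg c r) s v * recipNorm (ballAvg c r) 1 U ^ t *
        (recipNorm (ballAvg c r) a (fun x => (v x)⁻¹) *
          recipNorm (ballAvg c r) 0 (fun x => (U x)⁻¹) ^ t) := by
        refine mul_le_mul' h1 (h2.trans_eq ?_)
        rw [← e2]; rfl
    _ = (recipNorm (ballAvg c r) s v * recipNorm (ballAvg c r) a (fun x => (v x)⁻¹)) *
        (recipNorm (ballAvg c r) 1 U * recipNorm (ballAvg c r) 0 (fun x => (U x)⁻¹)) ^ t := by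
        rw [ENNReal.mul_rpow_of_nonneg _ _ ht]; ring
    _ ≤ _ := by gcongr; exacts [hbd c r hr, hA c r hr]

lemma ae_ne_top_of_average_le {U : (Fin d → ℝ) → ℝ≥0∞} (hU : Measurable U) {C : ℝ≥0∞}
    (hC : C ≠ ⊤) (hA : ∀ c r, ∀ x ∈ ball c r, ∫⁻ y in ball c r, U y ≤ C * U x * volume (ball c r))
    {x : Fin d → ℝ} (hx : U x ≠ ⊤) : ∀ᵐ y, U y ≠ ⊤ := by
  have h : ∀ n : ℕ, ∀ᵐ y, y ∈ ball x (n + 1) → U y ≠ ⊤ := fun n => by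
    rw [← ae_restrict_iff' measurableSet_ball]
    refine (ae_lt_top hU ?_).mono fun y hy => hy.ne
    exact ne_top_of_le_ne_top (ENNReal.mul_ne_top (ENNReal.mul_ne_top hC hx)
      (volume_ball_ne_top x _)) (hA x _ x (mem_ball_self (by positivity)))
  filter_upwards [ae_all_iff.2 h] with y hy
  obtain ⟨n, hn⟩ := exists_nat_gt (dist y x)
  exact hy n (mem_ball.2 (hn.trans (by linarith)))

lemma tsum_decay_const_ne_top {κ lam : ℝ} (h : lam < κ) :
    ∑' k : ℕ, ((2⁻¹ : ℝ≥0∞) ^ (κ - lam)) ^ k ≠ ⊤ := by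
  rw [ENNReal.tsum_geometric]
  refine ENNReal.inv_ne_top.2 (tsub_pos_of_lt ?_).ne'
  exact ENNReal.rpow_lt_one (by simp) (by linarith)

lemma lintegral_mul_decay_rpow_le_of_morrey {g : (Fin d → ℝ) → ℝ≥0∞} (hg : Measurable g)
    {κ lam : ℝ} (hκ : 0 ≤ κ) {L : ℝ≥0∞}
    (hL : ∀ c r, 0 < r → ∫⁻ x in ball c r, g x ≤ L * ENNReal.ofReal r ^ lam)
    (c : Fin d → ℝ) {r : ℝ} (hr : 0 < r) :
    ∫⁻ x, g x * (ENNReal.ofReal r ^ (-lam) * decay c r x ^ κ) ≤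
      2 ^ κ * (∑' k : ℕ, ((2⁻¹ : ℝ≥0∞) ^ (κ - lam)) ^ k) * L := by
  have hr0 : ENNReal.ofReal r ≠ 0 := by simpa using hr
  have hrt : ENNReal.ofReal r ≠ ⊤ := ENNReal.ofReal_ne_top
  calc _ = ENNReal.ofReal r ^ (-lam) * ∫⁻ x, g x * decay c r x ^ κ := by
        rw [← lintegral_const_mul' _ _ (by simp [hr0, hrt])]
        refine lintegral_congr fun x => mul_left_comm _ _ _
    _ ≤ ENNReal.ofReal r ^ (-lam) * (2 ^ κ * ∑' k : ℕ, ((2⁻¹ : ℝ≥0∞) ^ κ) ^ k *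
          (L * ENNReal.ofReal (2 ^ k * r) ^ lam)) := by
        gcongr
        refine (lintegral_mul_decay_rpow_le hg hκ hr).trans ?_
        gcongr with k
        exact hL c _ (by positivity)
    _ = ENNReal.ofReal r ^ (-lam) * (2 ^ κ * ∑' k : ℕ, ((2⁻¹ : ℝ≥0∞) ^ (κ - lam)) ^ k *
          (L * ENNReal.ofReal r ^ lam)) := by
        congr 3
        ext k
        have e : ENNReal.ofReal (2 ^ k * r) ^ lam =
            ((2⁻¹ : ℝ≥0∞) ^ (-lam)) ^ k * ENNReal.ofReal r ^ lam := by
          rw [ENNReal.ofReal_mul (by positivity), ENNReal.ofReal_pow (by norm_num),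
            ENNReal.ofReal_ofNat, ENNReal.mul_rpow_of_ne_top (by simp) hrt,
            ENNReal.inv_rpow, ENNReal.rpow_neg, inv_inv, ← ENNReal.rpow_natCast,
            ← ENNReal.rpow_natCast, ← ENNReal.rpow_mul, ← ENNReal.rpow_mul, mul_comm lam]
        rw [e, sub_eq_add_neg, ENNReal.rpow_add _ _ (by simp) (by simp), mul_pow]
        ring
    _ = _ := by
        have e : ENNReal.ofReal r ^ (-lam) * ENNReal.ofReal r ^ lam = 1 := by
          rw [← ENNReal.rpow_add _ _ hr0 hrt, neg_add_cancel, ENNReal.rpow_zero]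
        rw [ENNReal.tsum_mul_right]
        calc _ = (ENNReal.ofReal r ^ (-lam) * ENNReal.ofReal r ^ lam) *
              (2 ^ κ * (∑' k : ℕ, ((2⁻¹ : ℝ≥0∞) ^ (κ - lam)) ^ k) * L) := by ring
          _ = _ := by rw [e, one_mul]

end MorreyEstimates

section MorreyBound

variable {d : ℕ} {I : Type*}

/-- A positive measurable function satisfying the pointwise `A₁` condition and finite at some point
is almost everywhere equal to an everywhere finite `A₁` weight. -/
lemma exists_ae_eq_finite_of_average_le {U : (Fin d → ℝ) → ℝ≥0∞} (hU : Measurable U)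
    (hU0 : ∀ x, U x ≠ 0) {C : ℝ≥0∞} (hC : C ≠ ⊤)
    (hA : ∀ c r, ∀ x ∈ ball c r, ∫⁻ y in ball c r, U y ≤ C * U x * volume (ball c r))
    {x : Fin d → ℝ} (hx : U x ≠ ⊤) :
    ∃ V : (Fin d → ℝ) → ℝ≥0∞, Measurable V ∧ (∀ x, V x ≠ 0) ∧ (∀ x, V x ≠ ⊤) ∧ V =ᵐ[volume] U ∧
      ∀ c r, 0 < r → recipNorm (ballAvg c r) 1 V *
        recipNorm (ballAvg c r) 0 (fun x => (V x)⁻¹) ≤ C := by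
  have hVU : (fun x => if U x = ⊤ then 1 else U x) =ᵐ[volume] U := by
    filter_upwards [ae_ne_top_of_average_le hU hC hA hx] with y hy
    simp [hy]
  refine ⟨fun x => if U x = ⊤ then 1 else U x,
    Measurable.ite (hU (measurableSet_singleton ⊤)) measurable_const hU, fun x => ?_, fun x => ?_,
    hVU, fun c r hr => ?_⟩
  · beta_reduce; split_ifs
    exacts [one_ne_zero, hU0 x]
  · beta_reduce; split_ifs with hx
    exacts [one_ne_top, hx]
  · have := isProbabilityMeasure_ballAvg c hr
    refine recipNorm_one_mul_recipNorm_zero_inv_le ?_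
    have h1 := ae_ballAvg_of_ae hVU c r
    have h2 : ∀ᵐ x ∂ballAvg c r, x ∈ ball c r :=
      (ballAvg_absolutelyContinuous c r).ae_le (ae_restrict_mem measurableSet_ball)
    filter_upwards [h1, h2] with x hx hxB
    rw [recipNorm_congr_ae h1, hx, recipNorm_one_eq, lintegral_ballAvg]
    exact ENNReal.div_le_of_le_mul (hA c r x hxB)

lemma lintegral_ball_tsum_decay_le {κ : ℝ} (hκ : 0 ≤ κ) (α : ℕ → ℝ≥0∞)
    (c : ℕ → Fin d → ℝ) {r : ℕ → ℝ} (hr : ∀ n, 0 < r n) (y : Fin d → ℝ) (l : ℝ)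
    {x : Fin d → ℝ} (hx : x ∈ ball y l) :
    ∫⁻ z in ball y l, ∑' n, α n * decay (c n) (r n) z ^ κ ≤
      (1 + (1 - 2 ^ κ * 2⁻¹ ^ d)⁻¹ * 6 ^ d) * 2 ^ κ * (∑' n, α n * decay (c n) (r n) x ^ κ) *
        volume (ball y l) := by
  have hm := fun n => measurable_decay (c n) (r n)
  rw [lintegral_tsum fun n => by fun_prop, ← ENNReal.tsum_mul_left, ← ENNReal.tsum_mul_right]
  refine ENNReal.tsum_le_tsum fun n => ?_
  rw [lintegral_const_mul _ (by fun_prop)]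
  calc _ ≤ α n * _ := mul_le_mul_right (lintegral_ball_decay_rpow_le_mul hκ (hr n) hx) _
    _ = _ := by ring

/-- Boundedness on the weighted Lebesgue spaces whose weights have the form `v U ^ (e / p)` with
`U ∈ A₁` implies boundedness on the weighted Morrey space associated with `v`. -/
theorem exists_morrey_bound {F H : I → (Fin d → ℝ) → ℝ≥0∞} (hF : ∀ i, Measurable (F i))
    (hH : ∀ i, Measurable (H i)) {s a e p lam : ℝ} (hs : 0 ≤ s) (ha : 0 ≤ a) (he : 0 < e)
    (he1 : e ≤ 1) (hp : 0 < p) (hlam : 0 < lam) (hlamd : lam < d * e)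
    {v : (Fin d → ℝ) → ℝ≥0∞} (hv : InClass s a v)
    (hyp : ∀ v₁ : (Fin d → ℝ) → ℝ≥0∞, InClass (s + e / p) a v₁ → BddOn F H p v₁) :
    ∃ C : ℝ≥0∞, C ≠ ⊤ ∧ ∀ i L,
      (∀ c r, 0 < r → ∫⁻ x in ball c r, (F i x * v x) ^ p ≤ L * ENNReal.ofReal r ^ lam) →
      ∀ c r, 0 < r → ∫⁻ x in ball c r, (H i x * v x) ^ p ≤ C * L * ENNReal.ofReal r ^ lam := by
  by_contra hcon
  push Not at hcon
  have h4 : ∀ n : ℕ, (4 : ℝ≥0∞) ^ n ≠ ⊤ := fun n => by simp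
  choose i L hL c r hr hlt using fun n : ℕ => hcon (4 ^ n) (h4 n)
  have hvm := hv.meas
  set κ' : ℝ := (lam + d * e) / 2 / e with hκ'
  set κ : ℝ := (lam + d * e) / 2 with hκ
  have hκlam : lam < κ := by rw [hκ]; linarith
  have hκ0 : 0 ≤ κ := by linarith
  have hκ'0 : 0 ≤ κ' := by positivity
  have hκ'd : κ' < d := by rw [hκ', div_lt_iff₀ he]; linarith
  have hκe : κ' * e = κ := div_mul_cancel₀ _ he.ne'
  have hr0 : ∀ n, ENNReal.ofReal (r n) ≠ 0 := fun n => by simpa using hr n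
  have hrt : ∀ n, ENNReal.ofReal (r n) ≠ ⊤ := fun n => ENNReal.ofReal_ne_top
  have hrp0 : ∀ n, ENNReal.ofReal (r n) ^ (-lam) ≠ 0 := fun n => by simp [hr0 n, hrt n]
  have hrpt : ∀ n, ENNReal.ofReal (r n) ^ (-lam) ≠ ⊤ := fun n => by simp [hr0 n, hrt n]
  set β : ℕ → ℝ≥0∞ := fun n => 2⁻¹ ^ n * ENNReal.ofReal (r n) ^ (-lam) with hβ
  have hβ0 : ∀ n, β n ≠ 0 := fun n => mul_ne_zero (by simp) (hrp0 n)
  have hβt : ∀ n, β n ≠ ⊤ := fun n => ENNReal.mul_ne_top (by simp) (hrpt n)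
  have hdm := fun n => measurable_decay (c n) (r n)
  set U : (Fin d → ℝ) → ℝ≥0∞ := fun x => ∑' n, β n ^ (1 / e) * decay (c n) (r n) x ^ κ' with hU
  have hUm : Measurable U := Measurable.tsum fun n => by fun_prop
  have hterm : ∀ n x, (β n ^ (1 / e) * decay (c n) (r n) x ^ κ') ^ e =
      β n * decay (c n) (r n) x ^ κ := fun n x => by
    rw [ENNReal.mul_rpow_of_nonneg _ _ he.le, ← ENNReal.rpow_mul, ← ENNReal.rpow_mul,
      one_div_mul_cancel he.ne', ENNReal.rpow_one, hκe]
  have hUge : ∀ n x, x ∈ ball (c n) (r n) → β n ≤ U x ^ e := fun n x hx => by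
    calc β n = (β n ^ (1 / e) * decay (c n) (r n) x ^ κ') ^ e := by
          rw [hterm, decay_eq_one (hr n) hx]; simp
      _ ≤ _ := by gcongr; exact ENNReal.le_tsum (f := fun n => _) n
  have hU0 : ∀ x, U x ≠ 0 := fun x h0 => by
    have h1 : β 0 ^ (1 / e) * decay (c 0) (r 0) x ^ κ' = 0 := (ENNReal.tsum_eq_zero.1 h0) 0
    simp [hβ0 0, hβt 0, decay_ne_zero (hr 0), decay_ne_top] at h1
  set K : ℝ≥0∞ := 2 ^ κ * ∑' k : ℕ, ((2⁻¹ : ℝ≥0∞) ^ (κ - lam)) ^ k with hK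
  have hKt : K ≠ ⊤ := ENNReal.mul_ne_top (by simp) (tsum_decay_const_ne_top hκlam)
  have hup : ∀ n, ∫⁻ x, (F (i n) x * v x) ^ p * U x ^ e ≤ 2 * K * L n := fun n => by
    have hFm := hF (i n)
    calc _ ≤ ∫⁻ x, ∑' m, 2⁻¹ ^ m * ((F (i n) x * v x) ^ p *
          (ENNReal.ofReal (r m) ^ (-lam) * decay (c m) (r m) x ^ κ)) := by
          refine lintegral_mono fun x => ?_
          calc _ ≤ (F (i n) x * v x) ^ p * ∑' m, β m * decay (c m) (r m) x ^ κ := by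
                gcongr
                refine (rpow_tsum_le he he1 _).trans_eq ?_
                simp only [hterm]
            _ = _ := by
                rw [← ENNReal.tsum_mul_left]
                refine tsum_congr fun m => ?_
                simp only [hβ]; ring
      _ = ∑' m, 2⁻¹ ^ m * ∫⁻ x, (F (i n) x * v x) ^ p *
          (ENNReal.ofReal (r m) ^ (-lam) * decay (c m) (r m) x ^ κ) := by
          rw [lintegral_tsum fun m => by fun_prop]
          refine tsum_congr fun m => lintegral_const_mul _ (by fun_prop)
      _ ≤ ∑' m, 2⁻¹ ^ m * (K * L n) := by
          gcongr with m
          exact lintegral_mul_decay_rpow_le_of_morrey (by fun_prop) hκ0 (hL n) (c m) (hr m)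
      _ = _ := by rw [ENNReal.tsum_mul_right, ENNReal.tsum_geometric_two]; ring
  have hLt : ∀ n, L n ≠ ⊤ := fun n h => by
    have := hlt n
    rw [h, ENNReal.mul_top (by simp), ENNReal.top_mul (by simp [hr0 n, hrt n])] at this
    exact not_top_lt this
  have hfin : ∃ x, U x ≠ ⊤ := by
    by_contra! hall
    have h1 : ∫⁻ x, (F (i 0) x * v x) ^ p * ⊤ ≠ ⊤ := by
      refine ne_top_of_le_ne_top (ENNReal.mul_ne_top (ENNReal.mul_ne_top (by simp) hKt) (hLt 0))
        (le_trans (le_of_eq ?_) (hup 0))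
      simp only [hall, ENNReal.top_rpow_of_pos he]
    have hFm := hF (i 0)
    have h2 : ∫⁻ x, (F (i 0) x * v x) ^ p = 0 := by
      rw [lintegral_eq_zero_of_ae_eq_zero]
      filter_upwards [ae_lt_top (by fun_prop) h1] with x hx
      by_contra h0
      rw [ENNReal.mul_top h0] at hx
      exact not_top_lt hx
    obtain ⟨C, hC, hbd⟩ := hyp v (hv.mono hs (by linarith [div_pos he hp]))
    have h3 := hbd (i 0)
    rw [h2, mul_zero] at h3
    exact not_lt_bot ((hlt 0).trans_le ((setLIntegral_le_lintegral _ _).trans h3))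
  obtain ⟨x₀, hx₀⟩ := hfin
  have hA := fun y l x hx => lintegral_ball_tsum_decay_le (x := x) hκ'0
    (fun n => β n ^ (1 / e)) c hr y l hx
  have hCt : ((1 : ℝ≥0∞) + (1 - 2 ^ κ' * 2⁻¹ ^ d)⁻¹ * 6 ^ d) * 2 ^ κ' ≠ ⊤ := by
    refine ENNReal.mul_ne_top (ENNReal.add_ne_top.2 ⟨one_ne_top, ENNReal.mul_ne_top ?_ (by simp)⟩)
      (by simp)
    exact ENNReal.inv_ne_top.2 (tsub_pos_of_lt (two_rpow_mul_lt_one hκ'd)).ne'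
  obtain ⟨V, hVm, hV0, hVt, hVU, hVA⟩ := exists_ae_eq_finite_of_average_le hUm hU0 hCt hA hx₀
  obtain ⟨C, hC, hbd⟩ := hyp _ (hv.mul_rpow hs ha (div_pos he hp).le hVm hV0 hVt hCt hVA)
  have hint : ∀ (f : (Fin d → ℝ) → ℝ≥0∞),
      ∫⁻ x, (f x * (v x * V x ^ (e / p))) ^ p = ∫⁻ x, (f x * v x) ^ p * U x ^ e := fun f => by
    refine lintegral_congr_ae (hVU.mono fun x hx => ?_)
    simp only [hx]
    rw [← mul_assoc, ENNReal.mul_rpow_of_nonneg _ _ hp.le, ← ENNReal.rpow_mul,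
      div_mul_cancel₀ _ hp.ne']
  obtain ⟨n, hn⟩ := exists_lt_two_pow (ENNReal.mul_ne_top hC (ENNReal.mul_ne_top (by simp) hKt) :
    C * (2 * K) ≠ ⊤)
  have hHm := hH (i n)
  have hlow : 2 ^ n * L n < ∫⁻ x, (H (i n) x * v x) ^ p * U x ^ e := by
    calc 2 ^ n * L n = β n * (4 ^ n * L n * ENNReal.ofReal (r n) ^ lam) := by
          have e1 : ENNReal.ofReal (r n) ^ (-lam) * ENNReal.ofReal (r n) ^ lam = 1 := by
            rw [← ENNReal.rpow_add _ _ (hr0 n) (hrt n), neg_add_cancel, ENNReal.rpow_zero]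
          have e2 : (2⁻¹ : ℝ≥0∞) ^ n * 2 ^ n = 1 := by
            rw [← mul_pow, ENNReal.inv_mul_cancel (by simp) (by simp), one_pow]
          calc _ = ((2⁻¹ : ℝ≥0∞) ^ n * 2 ^ n) * (ENNReal.ofReal (r n) ^ (-lam) *
                ENNReal.ofReal (r n) ^ lam) * (2 ^ n * L n) := by rw [e1, e2]; simp
            _ = _ := by
                rw [show (4 : ℝ≥0∞) = 2 * 2 by norm_num, mul_pow]; simp only [hβ]; ring
      _ < β n * ∫⁻ x in ball (c n) (r n), (H (i n) x * v x) ^ p := by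
          rw [ENNReal.mul_lt_mul_iff_right (hβ0 n) (hβt n)]
          exact hlt n
      _ = ∫⁻ x in ball (c n) (r n), (H (i n) x * v x) ^ p * β n := by
          rw [lintegral_mul_const _ (by fun_prop), mul_comm]
      _ ≤ ∫⁻ x in ball (c n) (r n), (H (i n) x * v x) ^ p * U x ^ e := by
          refine setLIntegral_mono' measurableSet_ball fun x hx => ?_
          gcongr
          exact hUge n x hx
      _ ≤ _ := setLIntegral_le_lintegral _ _
  have h1 := hbd (i n)
  rw [hint, hint] at h1
  refine (lt_irrefl (2 ^ n * L n)) ?_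
  calc _ < _ := hlow
    _ ≤ C * (2 * K * L n) := h1.trans (by gcongr; exact hup n)
    _ = C * (2 * K) * L n := by ring
    _ ≤ _ := by gcongr

end MorreyBound

section CubeCharacteristics

/-! ### Measurable minorants -/

lemma exists_measurable_le_forall_setLIntegral_rpow_mul_eq {α : Type*} [MeasurableSpace α]
    {μ : Measure α} [SigmaFinite μ] (f : α → ℝ≥0∞) :
    ∃ g : α → ℝ≥0∞, Measurable g ∧ g ≤ f ∧ ∀ (p : ℝ) (W : α → ℝ≥0∞), 0 < p → Measurable W →
      (∀ x, W x ≠ 0) → (∀ x, W x ≠ ⊤) → ∀ s,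
        ∫⁻ x in s, f x ^ p * W x ∂μ = ∫⁻ x in s, g x ^ p * W x ∂μ := by
  obtain ⟨g, hg, hgf, hgs⟩ := exists_measurable_le_forall_setLIntegral_eq μ f
  refine ⟨g, hg, hgf, fun p W hp hW hW0 hWt s => le_antisymm ?_ ?_⟩
  · obtain ⟨k, hk, hkf, hks⟩ := exists_measurable_le_forall_setLIntegral_eq μ fun x => f x ^ p * W x
    rw [hks]
    have hle : (fun x => (k x / W x) ^ (1 / p)) ≤ᵐ[μ] g := by
      refine ae_le_of_forall_setLIntegral_le_of_sigmaFinite (by fun_prop) fun t _ _ => ?_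
      rw [← hgs]
      refine lintegral_mono fun x => ?_
      rw [one_div, ENNReal.rpow_inv_le_iff hp]
      exact ENNReal.div_le_of_le_mul (hkf x)
    refine lintegral_mono_ae (ae_restrict_of_ae (hle.mono fun x hx => ?_))
    rw [one_div, ENNReal.rpow_inv_le_iff hp,
      ENNReal.div_le_iff (hW0 x) (hWt x)] at hx
    exact hx
  · refine lintegral_mono fun x => ?_
    gcongr
    exact hgf x

/-! ### Cubes and balls -/

variable {d : ℕ}

lemma cube_ae_eq_ball (c : Fin d → ℝ) {r : ℝ} (hr : 0 < r) :
    cube (fun i => c i - r) (2 * r) =ᵐ[volume] ball c r := by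
  have h : cube (fun i => c i - r) (2 * r) = closedBall c r := by
    rw [closedBall_pi c hr.le, cube]
    congr 1
    ext1 i
    rw [Real.closedBall_eq_Icc]
    congr 1
    ring
  rw [h, ← ball_union_sphere]
  exact union_ae_eq_left_of_ae_eq_empty
    (ae_eq_empty.2 (Measure.addHaar_sphere_of_ne_zero volume c hr.ne'))

lemma forall_cube {P : (Fin d → ℝ) → ℝ → Prop} :
    (∀ a r, 0 < r → P a r) ↔ ∀ (c : Fin d → ℝ) r, 0 < r → P (fun i => c i - r) (2 * r) := by
  refine ⟨fun h c r hr => h _ _ (by positivity), fun h a r hr => ?_⟩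
  convert h (fun i => a i + r / 2) (r / 2) (by positivity) using 1
  · ext i; ring
  · ring

lemma avg_eq_lintegral_ballAvg (g : (Fin d → ℝ) → ℝ≥0∞) (c : Fin d → ℝ) {r : ℝ} (hr : 0 < r) :
    avg g (fun i => c i - r) (2 * r) = ∫⁻ x, g x ∂ballAvg c r := by
  rw [avg, lintegral_ballAvg, Measure.restrict_congr_set (cube_ae_eq_ball c hr),
    measure_congr (cube_ae_eq_ball c hr)]

lemma essSup_cube_eq_recipNorm (g : (Fin d → ℝ) → ℝ≥0∞) (c : Fin d → ℝ) {r : ℝ} (hr : 0 < r) :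
    essSup g (volume.restrict (cube (fun i => c i - r) (2 * r))) =
      recipNorm (ballAvg c r) 0 g := by
  rw [recipNorm_zero, Measure.restrict_congr_set (cube_ae_eq_ball c hr), ballAvg,
    essSup_ennreal_smul_measure (ENNReal.inv_ne_zero.2 (volume_ball_ne_top c r))]

/-! ### Muckenhoupt and reverse Hölder weights -/

variable {w : (Fin d → ℝ) → ℝ} {v : (Fin d → ℝ) → ℝ≥0∞} {p q : ℝ} {σ : ℝ≥0∞}

lemma IsWeight.exists_rpow (hw : IsWeight d w) (hp : 0 < p) :
    ∃ v : (Fin d → ℝ) → ℝ≥0∞, Measurable v ∧ (∀ x, v x ≠ 0) ∧ (∀ x, v x ≠ ⊤) ∧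
      ofW w =ᵐ[volume] fun x => v x ^ p := by
  obtain ⟨w', hw', hww'⟩ := hw.1.aestronglyMeasurable
  have hm := hw'.measurable
  refine ⟨fun x => if 0 < w' x then ENNReal.ofReal (w' x) ^ (1 / p) else 1,
    Measurable.ite (measurableSet_lt measurable_const hm) (by fun_prop) measurable_const,
    fun x => ?_, fun x => ?_, ?_⟩
  · beta_reduce; split_ifs with hx
    · simp [hx]
    · exact one_ne_zero
  · beta_reduce; split_ifs with hx
    · simp [hp.le]
    · exact one_ne_top
  · filter_upwards [hw.2, hww'] with x hx hxw
    rw [hxw] at hx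
    rw [if_pos hx, ← ENNReal.rpow_mul, one_div_mul_cancel hp.ne', ENNReal.rpow_one, ofW, hxw]

lemma lintegral_ballAvg_rpow_of_pos {t : ℝ} (ht : 0 < t) (u : (Fin d → ℝ) → ℝ≥0∞)
    (c : Fin d → ℝ) (r : ℝ) :
    ∫⁻ x, u x ^ t ∂ballAvg c r = recipNorm (ballAvg c r) (1 / t) u ^ t := by
  rw [recipNorm_of_ne (by positivity), ← ENNReal.rpow_mul, one_div_one_div,
    one_div_mul_cancel ht.ne', ENNReal.rpow_one]

lemma avg_ofW (hv : ofW w =ᵐ[volume] fun x => v x ^ p) (hp : 0 < p) (c : Fin d → ℝ)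
    {r : ℝ} (hr : 0 < r) :
    avg (ofW w) (fun i => c i - r) (2 * r) = recipNorm (ballAvg c r) (1 / p) v ^ p := by
  rw [avg_eq_lintegral_ballAvg _ _ hr, lintegral_congr_ae (ae_ballAvg_of_ae hv c r),
    lintegral_ballAvg_rpow_of_pos hp]

lemma iSup_cube_rpow_ne_top_iff {Φ : (Fin d → ℝ) → ℝ → ℝ≥0∞} {Ψ : (Fin d → ℝ) → ℝ → ℝ≥0∞}
    (hp : 0 < p) (h : ∀ (c : Fin d → ℝ) r, 0 < r → Φ (fun i => c i - r) (2 * r) = Ψ c r ^ p) :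
    (⨆ (a : Fin d → ℝ) (r : ℝ) (_ : 0 < r), Φ a r) ≠ ⊤ ↔
      ∃ C : ℝ≥0∞, C ≠ ⊤ ∧ ∀ c r, 0 < r → Ψ c r ≤ C := by
  constructor
  · intro hne
    refine ⟨(⨆ (a : Fin d → ℝ) (r : ℝ) (_ : 0 < r), Φ a r) ^ p⁻¹,
      ENNReal.rpow_ne_top_of_nonneg (by positivity) hne, fun c r hr => ?_⟩
    rw [ENNReal.le_rpow_inv_iff hp, ← h c r hr]
    have h2 : 0 < 2 * r := by positivity
    exact le_iSup_of_le _ (le_iSup_of_le (2 * r) (le_iSup_of_le h2 le_rfl))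
  · rintro ⟨C, hC, hle⟩
    refine ne_top_of_le_ne_top (ENNReal.rpow_ne_top_of_nonneg hp.le hC)
      (iSup_le fun a => iSup_le fun r => iSup_le fun hr => ?_)
    revert a r
    rw [forall_cube]
    intro c r hr
    rw [h c r hr]
    gcongr
    exact hle c r hr

lemma apConst_ne_top_iff (hp : 0 < p) (hq : 1 ≤ q) (hv : ofW w =ᵐ[volume] fun x => v x ^ p) :
    apConst d q w ≠ ⊤ ↔ ∃ C : ℝ≥0∞, C ≠ ⊤ ∧ ∀ c r, 0 < r →
      recipNorm (ballAvg c r) (1 / p) v *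
        recipNorm (ballAvg c r) ((q - 1) / p) (fun x => (v x)⁻¹) ≤ C := by
  rw [apConst]
  split_ifs with h
  · refine iSup_cube_rpow_ne_top_iff hp fun c r hr => ?_
    rw [avg_ofW hv hp c hr, essSup_cube_eq_recipNorm _ c hr, ENNReal.mul_rpow_of_nonneg _ _ hp.le,
      h, sub_self, ← recipNorm_rpow (b := 0) hp]
    congr 1
    refine recipNorm_congr_ae ((ae_ballAvg_of_ae hv c r).mono fun x hx => ?_)
    simp only [hx, ENNReal.inv_rpow]
  · have hq' : 0 < q - 1 := sub_pos.2 (lt_of_le_of_ne hq (Ne.symm h))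
    refine iSup_cube_rpow_ne_top_iff hp fun c r hr => ?_
    rw [avg_ofW hv hp c hr, avg_eq_lintegral_ballAvg _ _ hr, ENNReal.mul_rpow_of_nonneg _ _ hp.le]
    congr 1
    have h1 : ∫⁻ x, ofW w x ^ (-(1 / (q - 1))) ∂ballAvg c r =
        ∫⁻ x, (v x)⁻¹ ^ (p / (q - 1)) ∂ballAvg c r := by
      refine lintegral_congr_ae ((ae_ballAvg_of_ae hv c r).mono fun x hx => ?_)
      simp only [hx]
      rw [← ENNReal.rpow_mul, ENNReal.inv_rpow, ← ENNReal.rpow_neg]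
      congr 1
      ring
    rw [h1, lintegral_ballAvg_rpow_of_pos (by positivity), one_div_div, ← ENNReal.rpow_mul,
      div_mul_cancel₀ _ hq'.ne']

lemma rhConst_ne_top_iff (hp : 0 < p) (hσ : 1 < σ) (hv : ofW w =ᵐ[volume] fun x => v x ^ p) :
    rhConst d σ w ≠ ⊤ ↔ ∃ C : ℝ≥0∞, C ≠ ⊤ ∧ ∀ c r, 0 < r →
      recipNorm (ballAvg c r) (σ.toReal⁻¹ / p) v / recipNorm (ballAvg c r) (1 / p) v ≤ C := by
  rw [rhConst, if_neg hσ.ne']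
  split_ifs with h
  · refine iSup_cube_rpow_ne_top_iff hp fun c r hr => ?_
    rw [avg_ofW hv hp c hr, essSup_cube_eq_recipNorm _ c hr, ENNReal.div_rpow_of_nonneg _ _ hp.le,
      recipNorm_congr_ae (ae_ballAvg_of_ae hv c r), recipNorm_rpow hp, h]
    simp
  · have hσ0 : 0 < σ.toReal := ENNReal.toReal_pos (zero_lt_one.trans hσ).ne' h
    refine iSup_cube_rpow_ne_top_iff hp fun c r hr => ?_
    rw [avg_ofW hv hp c hr, avg_eq_lintegral_ballAvg _ _ hr, ENNReal.div_rpow_of_nonneg _ _ hp.le,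
      lintegral_ballAvg_rpow_of_pos hσ0, ← ENNReal.rpow_mul, mul_one_div_cancel hσ0.ne',
      ENNReal.rpow_one, recipNorm_congr_ae (ae_ballAvg_of_ae hv c r), recipNorm_rpow hp, one_div]

end CubeCharacteristics

section WeightClasses

variable {d : ℕ} {w : (Fin d → ℝ) → ℝ} {v : (Fin d → ℝ) → ℝ≥0∞} {p q r : ℝ}

lemma one_lt_eConj {t : ℝ} : 1 < eConj t := by
  rw [eConj]
  split_ifs with h
  · exact one_lt_top
  · rw [← ENNReal.ofReal_one]
    have : 0 < t - 1 := by linarith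
    have : 0 < t := by linarith
    refine (ENNReal.ofReal_lt_ofReal_iff (by positivity)).2 ?_
    rw [lt_div_iff₀ (by assumption)]
    linarith

lemma inv_toReal_eConj {t : ℝ} (ht : 1 ≤ t) : (eConj t).toReal⁻¹ = 1 - 1 / t := by
  rw [eConj]
  split_ifs with h
  · simp [le_antisymm h ht]
  · have : 0 < t - 1 := by linarith
    have : 0 < t := by linarith
    rw [ENNReal.toReal_ofReal (by positivity)]
    field_simp

lemma InClass.ofW_toReal {b a : ℝ} (h : InClass b a v) :
    (ofW fun x => (v x ^ p).toReal) = fun x => v x ^ p := by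
  ext x
  exact ENNReal.ofReal_toReal (by simp [h.ne_zero x, h.ne_top x])

lemma InClass.isWeight {b a : ℝ} (h : InClass b a v) (ha : 0 ≤ a) (hp : 0 < p) (hb : 0 ≤ b)
    (hbp : b ≤ 1 / p) : IsWeight d fun x => (v x ^ p).toReal := by
  have hv := h.meas
  constructor
  · intro x
    refine ⟨ball x 1, ball_mem_nhds x one_pos, integrable_toReal_of_lintegral_ne_top
      (by fun_prop) ?_⟩
    have hN : recipNorm (ballAvg x 1) (1 / p) v ≠ ⊤ := by
      have := isProbabilityMeasure_ballAvg x one_pos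
      exact ne_top_of_le_ne_top (h.recipNorm_ne_top ha x one_pos)
        (recipNorm_le_recipNorm hb hbp hv.aemeasurable)
    have h1 := lintegral_ballAvg_rpow_of_pos hp v x 1
    rw [lintegral_ballAvg] at h1
    rw [← ENNReal.div_mul_cancel (volume_ball_ne_zero x one_pos) (volume_ball_ne_top x 1)
      (b := ∫⁻ y in ball x 1, v y ^ p), h1]
    exact ENNReal.mul_ne_top (ENNReal.rpow_ne_top_of_nonneg hp.le hN) (volume_ball_ne_top x 1)
  · refine ae_of_all _ fun x => ENNReal.toReal_pos ?_ ?_ <;> simp [h.ne_zero x, h.ne_top x]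

lemma InClass.memAp_and_memRH (hq : 0 < q) (hqp : q ≤ p) (hpr : p ≤ r)
    (h : InClass (1 / p - 1 / r) (1 / q - 1 / p) v) :
    MemAp d (p / q) (fun x => (v x ^ p).toReal) ∧
      MemRH d (eConj (r / p)) (fun x => (v x ^ p).toReal) := by
  have hv := h.meas
  have hp : 0 < p := hq.trans_le hqp
  have hr : 0 < r := hp.trans_le hpr
  have ha : 0 ≤ 1 / q - 1 / p := sub_nonneg.2 (one_div_le_one_div_of_le hq hqp)
  have hb : 0 ≤ 1 / p - 1 / r := sub_nonneg.2 (one_div_le_one_div_of_le hp hpr)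
  have hbp : 1 / p - 1 / r ≤ 1 / p := by linarith [one_div_pos.2 hr]
  have hw := h.isWeight ha hp hb hbp
  have hvw : (ofW fun x => (v x ^ p).toReal) =ᵐ[volume] fun x => v x ^ p := by
    rw [h.ofW_toReal]
  obtain ⟨C, hC, hbd⟩ := h.bound
  refine ⟨⟨hw, (apConst_ne_top_iff hp ((one_le_div hq).2 hqp) hvw).2 ⟨C, hC, fun c l hl => ?_⟩⟩,
    ⟨hw, (rhConst_ne_top_iff hp one_lt_eConj hvw).2 ⟨C, hC, fun c l hl => ?_⟩⟩⟩
  · have := isProbabilityMeasure_ballAvg c hl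
    rw [show (p / q - 1) / p = 1 / q - 1 / p by field_simp]
    refine le_trans ?_ (hbd c l hl)
    gcongr
    exact recipNorm_le_recipNorm hb hbp hv.aemeasurable
  · rw [inv_toReal_eConj ((one_le_div hp).2 hpr),
      show (1 - 1 / (r / p)) / p = 1 / p - 1 / r by field_simp]
    refine ENNReal.div_le_of_le_mul ?_
    calc recipNorm (ballAvg c l) (1 / p - 1 / r) v
        ≤ recipNorm (ballAvg c l) (1 / p - 1 / r) v * (recipNorm (ballAvg c l) (1 / p) v *
          recipNorm (ballAvg c l) (1 / q - 1 / p) fun x => (v x)⁻¹) :=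
          le_mul_of_one_le_right bot_le (h.one_le (one_div_nonneg.2 hp.le) ha c hl)
      _ = (recipNorm (ballAvg c l) (1 / p - 1 / r) v *
          recipNorm (ballAvg c l) (1 / q - 1 / p) fun x => (v x)⁻¹) *
          recipNorm (ballAvg c l) (1 / p) v := by ring
      _ ≤ _ := by gcongr; exact hbd c l hl

lemma inClass_of_memAp_of_memRH {σ : ℝ} (hq : 0 < q) (hqp : q ≤ p) (hσ : 1 < σ)
    (hA : MemAp d (p / q) w) (hR : MemRH d (ENNReal.ofReal σ) w) (hvm : Measurable v)
    (hv0 : ∀ x, v x ≠ 0) (hvt : ∀ x, v x ≠ ⊤) (hv : ofW w =ᵐ[volume] fun x => v x ^ p) :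
    InClass (1 / (σ * p)) (1 / q - 1 / p) v := by
  have hp : 0 < p := hq.trans_le hqp
  obtain ⟨C, hC, hbd⟩ := (apConst_ne_top_iff hp ((one_le_div hq).2 hqp) hv).1 hA.2
  obtain ⟨C', hC', hbd'⟩ := (rhConst_ne_top_iff hp
    (by rwa [ENNReal.one_lt_ofReal]) hv).1 hR.2
  rw [ENNReal.toReal_ofReal (by linarith)] at hbd'
  rw [show (p / q - 1) / p = 1 / q - 1 / p by field_simp] at hbd
  have ha : 0 ≤ 1 / q - 1 / p := sub_nonneg.2 (one_div_le_one_div_of_le hq hqp)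
  refine ⟨hvm, hv0, hvt, C' * C, ENNReal.mul_ne_top hC' hC, fun c l hl => ?_⟩
  have := isProbabilityMeasure_ballAvg c hl
  have h1 := one_le_recipNorm_mul_inv (μ := ballAvg c l) (one_div_nonneg.2 hp.le) ha
    hvm.aemeasurable (ae_of_all _ fun x => ⟨hv0 x, hvt x⟩)
  have hne0 : recipNorm (ballAvg c l) (1 / p) v ≠ 0 := fun h0 => by
    rw [h0, zero_mul] at h1
    exact absurd h1 (by simp)
  have hnet : recipNorm (ballAvg c l) (1 / p) v ≠ ⊤ := fun h0 => by
    have h2 := hbd c l hl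
    rw [h0, ENNReal.top_mul (right_ne_zero_of_mul (zero_lt_one.trans_le h1).ne')] at h2
    exact hC (top_le_iff.1 h2)
  have h2 := hbd' c l hl
  rw [ENNReal.div_le_iff hne0 hnet, show σ⁻¹ / p = 1 / (σ * p) by field_simp] at h2
  calc _ ≤ C' * recipNorm (ballAvg c l) (1 / p) v * _ := mul_le_mul_left h2 _
    _ ≤ _ := by rw [mul_assoc]; gcongr; exact hbd c l hl

lemma morreyNorm_le_iff (hd : 0 < d) (hp : 0 < p) {lam : ℝ} (f : (Fin d → ℝ) → ℂ) (M : ℝ≥0∞) :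
    morreyNorm d p lam w f ≤ M ↔ ∀ c r, 0 < r →
      ∫⁻ x in ball c r, (‖f x‖₊ : ℝ≥0∞) ^ p * ofW w x ≤
        M ^ p * ENNReal.ofReal (2 * r) ^ lam := by
  have hd' : (0 : ℝ) < d := by exact_mod_cast hd
  simp only [morreyNorm, iSup_le_iff]
  rw [forall_cube]
  refine forall_congr' fun c => forall_congr' fun r => forall_congr' fun hr => ?_
  have h0 : ENNReal.ofReal (2 * r) ≠ 0 := by simpa using hr
  have ht : ENNReal.ofReal (2 * r) ≠ ⊤ := ENNReal.ofReal_ne_top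
  rw [Measure.restrict_congr_set (cube_ae_eq_ball c hr), measure_congr (cube_ae_eq_ball c hr),
    Real.volume_pi_ball _ hr, Fintype.card_fin, ENNReal.ofReal_pow (by positivity),
    ← ENNReal.rpow_natCast, ← ENNReal.rpow_mul,
    show (d : ℝ) * -(lam / (d * p)) = -lam * (1 / p) by field_simp, ENNReal.rpow_mul,
    ← ENNReal.mul_rpow_of_nonneg _ _ (by positivity), one_div, ENNReal.rpow_inv_le_iff hp,
    ENNReal.rpow_neg, mul_comm, ← div_eq_mul_inv,
    ENNReal.div_le_iff (ENNReal.rpow_pos (pos_iff_ne_zero.2 h0) ht).ne'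
      (ENNReal.rpow_ne_top_of_ne_zero h0 ht)]

end WeightClasses

end PaperMorrey

open PaperMorrey MeasureTheory ENNReal

/-- **Limited-range Duoandikoetxea–Rosenthal extrapolation to weighted Morrey spaces.**
Let `1 ≤ p₋ ≤ p₁ ≤ p₊ < ∞` and let `T` be defined and bounded on `L^{p₁}(w)` for all
`w ∈ A_{p₁/p₋} ∩ RH_{(p₊/p₁)'}`. Then for all `p ∈ (p₋,p₊)` (also `p = p₋` if
`p₁ = p₋`) and all `σ > (p₊/p)'`, `T` is bounded on `𝓛^{p,λ}(w)` for all
`0 < λ < d(1 - p/p₊ - 1/σ)` and all `w ∈ A_{p/p₋} ∩ RH_σ`. -/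
theorem limited_range_duoandikoetxea_rosenthal_extrapolation
    (d : ℕ) (pMinus p1 pPlus : ℝ)
    (h1 : 1 ≤ pMinus) (h2 : pMinus ≤ p1) (h3 : p1 ≤ pPlus)
    (T : ((Fin d → ℝ) → ℂ) → ((Fin d → ℝ) → ℂ))
    (hbdd : ∀ w : (Fin d → ℝ) → ℝ,
      MemAp d (p1 / pMinus) w → MemRH d (eConj (pPlus / p1)) w →
      OpBounded (wLpNorm d p1 w) (wLpNorm d p1 w) T) :
    ∀ (p σ lam : ℝ) (w : (Fin d → ℝ) → ℝ),
      ((pMinus < p ∧ p < pPlus) ∨ (p = pMinus ∧ p1 = pMinus)) →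
      eConj (pPlus / p) < ENNReal.ofReal σ →
      0 < lam → lam < d * (1 - p / pPlus - 1 / σ) →
      MemAp d (p / pMinus) w → MemRH d (ENNReal.ofReal σ) w →
      OpBounded (morreyNorm d p lam w) (morreyNorm d p lam w) T := by
  intro p σ lam w hcase hσ hlam hlamd hA hR
  have hM : 0 < pMinus := by linarith
  have hp1 : 0 < p1 := by linarith
  have hP : 0 < pPlus := by linarith
  have hMp : pMinus ≤ p := by
    rcases hcase with ⟨h, -⟩ | ⟨h, -⟩
    exacts [h.le, h.ge]
  have hp : 0 < p := hM.trans_le hMp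
  have hpP : p < pPlus := by
    by_contra! h
    rw [eConj, if_pos ((div_le_one hp).2 h)] at hσ
    exact not_top_lt hσ
  have hσ1 : 1 < σ := ENNReal.one_lt_ofReal.1 (one_lt_eConj.trans hσ)
  have hσ0 : 0 < σ := by linarith
  have he : 0 < 1 - p / pPlus - 1 / σ := by
    have ht : 1 < pPlus / p := (one_lt_div hp).2 hpP
    have h4 := inv_toReal_eConj ht.le
    have h5 : (eConj (pPlus / p)).toReal < σ := by
      have := (ENNReal.toReal_lt_toReal (ne_top_of_lt hσ) ENNReal.ofReal_ne_top).2 hσ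
      rwa [ENNReal.toReal_ofReal hσ0.le] at this
    have h6 : 0 < (eConj (pPlus / p)).toReal := ENNReal.toReal_pos
      (zero_lt_one.trans one_lt_eConj).ne' (ne_top_of_lt hσ)
    have h7 := one_div_lt_one_div_of_lt h6 h5
    rw [one_div (eConj _).toReal, h4, one_div_div] at h7
    linarith
  have he1 : 1 - p / pPlus - 1 / σ ≤ 1 := by
    have : 0 < p / pPlus := by positivity
    have : 0 < 1 / σ := by positivity
    linarith
  have hd : 0 < d := Nat.pos_of_ne_zero fun h => by
    rw [h] at hlamd
    norm_num at hlamd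
    linarith
  obtain ⟨v, hvm, hv0, hvt, hv⟩ := hA.1.exists_rpow hp
  choose k hk hkle hkint using fun f : (Fin d → ℝ) → ℂ =>
    exists_measurable_le_forall_setLIntegral_rpow_mul_eq (μ := volume) fun x => (‖f x‖₊ : ℝ≥0∞)
  have hkv : ∀ f (q : ℝ) (u : (Fin d → ℝ) → ℝ≥0∞), 0 < q → Measurable u → (∀ x, u x ≠ 0) →
      (∀ x, u x ≠ ⊤) → ∀ s, ∫⁻ x in s, (‖f x‖₊ : ℝ≥0∞) ^ q * u x ^ q =
        ∫⁻ x in s, (k f x * u x) ^ q := fun f q u hq hu hu0 hut s => by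
    rw [hkint f q (fun x => u x ^ q) hq (by fun_prop) (fun x => by simp [hu0, hut])
      (fun x => by simp [hu0, hut])]
    simp only [ENNReal.mul_rpow_of_nonneg _ _ hq.le]
  have hbase : ∀ u : (Fin d → ℝ) → ℝ≥0∞, InClass (1 / p1 - 1 / pPlus) (1 / pMinus - 1 / p1) u →
      BddOn k (fun f => k (T f)) p1 u := fun u hu => by
    obtain ⟨hA', hR'⟩ := hu.memAp_and_memRH hM h2 h3
    obtain ⟨C, hC, hbd⟩ := hbdd _ hA' hR'
    refine ⟨C ^ p1, ENNReal.rpow_ne_top_of_nonneg hp1.le hC, fun f => ?_⟩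
    have h4 := hbd f
    simp only [wLpNorm, hu.ofW_toReal] at h4
    have e := fun g => hkv g p1 u hp1 hu.meas hu.ne_zero hu.ne_top Set.univ
    simp only [Measure.restrict_univ] at e
    rw [e, e, one_div, ENNReal.rpow_inv_le_iff hp1, ENNReal.mul_rpow_of_nonneg _ _ hp1.le,
      ENNReal.rpow_inv_rpow hp1.ne'] at h4
    exact h4
  have hmid : ∀ u : (Fin d → ℝ) → ℝ≥0∞, InClass (1 / p - 1 / pPlus) (1 / pMinus - 1 / p) u →
      BddOn k (fun f => k (T f)) p u := fun u hu => by
    rcases hcase with ⟨hlt, -⟩ | ⟨rfl, rfl⟩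
    · exact bddOn_of_bddOn hk (fun f => hk _)
        (fun f x => ne_top_of_le_ne_top ENNReal.coe_ne_top (hkle (T f) x)) hM h2 h3 hbase hlt hpP hu
    · exact hbase u hu
  have hvc := inClass_of_memAp_of_memRH hM hMp hσ1 hA hR hvm hv0 hvt hv
  obtain ⟨C, hC, hbd⟩ := exists_morrey_bound hk (fun f => hk (T f)) (by positivity)
    (sub_nonneg.2 (one_div_le_one_div_of_le hM hMp)) he he1 hp hlam hlamd hvc
    fun v₁ hv₁ => hmid v₁ (by convert hv₁ using 1; field_simp; ring)
  have hkw : ∀ f c r, ∫⁻ x in Metric.ball c r, (‖f x‖₊ : ℝ≥0∞) ^ p * ofW w x =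
      ∫⁻ x in Metric.ball c r, (k f x * v x) ^ p := fun f c r => by
    rw [← hkv f p v hp hvm hv0 hvt]
    exact lintegral_congr_ae (ae_restrict_of_ae (hv.mono fun x hx => by simp only [hx]))
  have htwo : ∀ (M : ℝ≥0∞) (r : ℝ), M * ENNReal.ofReal (2 * r) ^ lam =
      M * 2 ^ lam * ENNReal.ofReal r ^ lam := fun M r => by
    rw [ENNReal.ofReal_mul zero_le_two, ENNReal.ofReal_ofNat,
      ENNReal.mul_rpow_of_nonneg _ _ hlam.le, mul_assoc]
  refine ⟨C ^ p⁻¹, ENNReal.rpow_ne_top_of_nonneg (by positivity) hC, fun f => ?_⟩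
  rw [morreyNorm_le_iff hd hp]
  intro c r hr
  have hf := (morreyNorm_le_iff (w := w) (lam := lam) hd hp f _).1 le_rfl
  simp only [hkw, htwo] at hf ⊢
  refine (hbd f _ hf c r hr).trans_eq ?_
  rw [ENNReal.mul_rpow_of_nonneg _ _ hp.le, ENNReal.rpow_inv_rpow hp.ne']
  ring
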